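/- arXiv:2203.00248 — 2 statements merged into one kernel-verified Lean document; each statement's English description precedes it below -/
import Mathlib

section
/- For every positive integer n and every integer s with 0 ≤ s ≤ 8, the polynomial g₁(x) = g₁(x,n,s) is irreducible over ℚ. In particular (the case s = 0, due to Schur), the truncated exponential n!·∑_{j=0}^{n} x^j/j! is irreducible over ℚ for every n ≥ 1. -/
open Polynomial Finset

/-- g₁(x,n,s) = n!·∑_{j=0}^{n} C(n+s−j, n−j)·x^j/j!, as a polynomial over ℚ. -/
noncomputable def g1 (n s : ℕ) : ℚ[X] :=
  (n.factorial : ℚ[X]) *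
    ∑ j ∈ Finset.range (n + 1),
      Polynomial.C (((n + s - j).choose (n - j) : ℚ) / (j.factorial : ℚ)) * Polynomial.X ^ j

/-- `x / e` is the negative of a slope of the `p`-adic Newton polygon of `G`: the minimum over `i` of
`e * v_p (G_i) + i * x` is attained at least twice. -/
def IsNewtonSlope (G : ℤ[X]) (p e x : ℕ) : Prop :=
  ∀ j, G.coeff j ≠ 0 → ∃ i, i ≠ j ∧ G.coeff i ≠ 0 ∧
    e * padicValInt p (G.coeff i) + i * x ≤ e * padicValInt p (G.coeff j) + j * x

section DedekindDomain

variable {S : Type*} [CommRing S] [IsDedekindDomain S]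

lemma emultiplicity_span_mul {P : Ideal S} (hP : Prime P) (a b : S) :
    emultiplicity P (Ideal.span {a * b}) =
      emultiplicity P (Ideal.span {a}) + emultiplicity P (Ideal.span {b}) := by
  rw [← Ideal.span_singleton_mul_span_singleton, emultiplicity_mul hP]

lemma emultiplicity_span_pow {P : Ideal S} (hP : Prime P) (a : S) (k : ℕ) :
    emultiplicity P (Ideal.span {a ^ k}) = k * emultiplicity P (Ideal.span {a}) := by
  rw [← Ideal.span_singleton_pow, emultiplicity_pow hP]

lemma emultiplicity_span_intCast {P : Ideal S} (hP : Prime P) {p : ℕ} (hp : p.Prime)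
    (hpP : (p : S) ∈ P) {a : ℤ} (ha : a ≠ 0) :
    emultiplicity P (Ideal.span {(a : S)}) =
      padicValInt p a * emultiplicity P (Ideal.span {(p : S)}) := by
  have := Fact.mk hp
  obtain ⟨u, hu⟩ := padicValInt_dvd (p := p) a
  have hpu : ¬ (p : ℤ) ∣ u := by
    rintro ⟨w, rfl⟩
    have h2 : (p : ℤ) ^ (padicValInt p a + 1) ∣ a := ⟨w, by rw [pow_succ, mul_assoc]; exact hu⟩
    rw [padicValInt_dvd_iff] at h2
    omega
  have hu0 : emultiplicity P (Ideal.span {(u : S)}) = 0 := by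
    rw [emultiplicity_eq_zero, Ideal.dvd_span_singleton]
    intro huP
    have hcop : IsCoprime (p : ℤ) u :=
      (Nat.prime_iff_prime_int.mp hp).coprime_iff_not_dvd.mpr hpu
    obtain ⟨s, t, hst⟩ := hcop
    have h1 : (1 : S) = s * (p : S) + t * (u : S) := by
      exact_mod_cast congrArg (Int.cast : ℤ → S) hst.symm
    exact (Ideal.isPrime_of_prime hP).ne_top ((Ideal.eq_top_iff_one _).mpr
      (h1 ▸ P.add_mem (P.mul_mem_left _ hpP) (P.mul_mem_left _ huP)))
  conv_lhs => rw [hu]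
  push_cast
  rw [emultiplicity_span_mul hP, emultiplicity_span_pow hP, hu0, add_zero]

lemma isNewtonSlope_of_aeval_eq_zero {P : Ideal S} (hP : Prime P) {p : ℕ} (hp : p.Prime)
    (hpP : (p : S) ∈ P) {G : ℤ[X]} {α : S} (hα : aeval α G = 0) {e x : ℕ}
    (he : emultiplicity P (Ideal.span {(p : S)}) = e)
    (hx : emultiplicity P (Ideal.span {α}) = x) : IsNewtonSlope G p e x := by
  intro j hj
  by_contra! hcon
  have hterm (i : ℕ) (hi : G.coeff i ≠ 0) :
      emultiplicity P (Ideal.span {(G.coeff i : S) * α ^ i}) =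
        ((e * padicValInt p (G.coeff i) + i * x : ℕ) : ℕ∞) := by
    rw [emultiplicity_span_mul hP, emultiplicity_span_pow hP,
      emultiplicity_span_intCast hP hp hpP hi, he, hx]
    push_cast
    ring
  set T := e * padicValInt p (G.coeff j) + j * x with hT
  rw [aeval_eq_sum_range, ← Finset.add_sum_erase _ _
    (Finset.mem_range.mpr (Nat.lt_succ_of_le (le_natDegree_of_ne_zero hj)))] at hα
  have hmem : ∑ i ∈ (Finset.range (G.natDegree + 1)).erase j, G.coeff i • α ^ i ∈ P ^ (T + 1) := by
    refine Ideal.sum_mem _ fun i hi => ?_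
    by_cases h0 : G.coeff i = 0
    · simp [h0]
    rw [← Ideal.dvd_span_singleton, pow_dvd_iff_le_emultiplicity, zsmul_eq_mul, hterm i h0]
    exact_mod_cast hcon i (Finset.ne_of_mem_erase hi) h0
  have hmem' : (G.coeff j : S) * α ^ j ∈ P ^ (T + 1) := by
    rw [← zsmul_eq_mul, eq_neg_of_add_eq_zero_left hα]
    exact neg_mem hmem
  rw [← Ideal.dvd_span_singleton, pow_dvd_iff_le_emultiplicity, hterm j hj] at hmem'
  have : T + 1 ≤ T := by exact_mod_cast hmem'
  omega

end DedekindDomain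

section NumberField
open NumberField

variable {f G : ℤ[X]}

theorem exists_numberField_root (hf : f.Monic) (hirr : Irreducible f) :
    ∃ (K : Type) (_ : Field K) (_ : NumberField K) (α : 𝓞 K), aeval α f = 0 ∧
      Module.finrank ℤ (𝓞 K) = f.natDegree ∧
      (Algebra.norm ℤ α).natAbs = (f.coeff 0).natAbs := by
  have hirrQ : Irreducible (f.map (Int.castRingHom ℚ)) :=
    (hf.irreducible_iff_irreducible_map_fraction_map (K := ℚ)).mp hirr
  have hmQ := hf.map (Int.castRingHom ℚ)
  have := Fact.mk hirrQ
  let K := AdjoinRoot (f.map (Int.castRingHom ℚ))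
  have : CharZero K := charZero_of_injective_algebraMap (algebraMap ℚ K).injective
  let pb := AdjoinRoot.powerBasis hirrQ.ne_zero
  have : FiniteDimensional ℚ K := pb.finite
  have : NumberField K := ⟨⟩
  let a : K := AdjoinRoot.root (f.map (Int.castRingHom ℚ))
  have ha : aeval a f = 0 := by
    have := AdjoinRoot.eval₂_root (f.map (Int.castRingHom ℚ))
    rw [eval₂_map] at this
    rw [aeval_def, ← this]
    exact eval₂_congr (RingHom.ext_int _ _) rfl rfl
  let α : 𝓞 K := ⟨a, ⟨f, hf, by rwa [← aeval_def]⟩⟩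
  have hdeg : Module.finrank ℚ K = f.natDegree := by
    rw [pb.finrank, AdjoinRoot.powerBasis_dim, hf.natDegree_map]
  refine ⟨K, inferInstance, inferInstance, α, ?_, ?_, ?_⟩
  · have h := ha
    apply RingOfIntegers.coe_injective
    rw [map_zero, ← h]
    exact (aeval_algebraMap_apply K α f).symm
  · rw [RingOfIntegers.rank, hdeg]
  · have h1 : ((Algebra.norm ℤ α : ℤ) : ℚ) = (-1) ^ f.natDegree * (f.coeff 0 : ℤ) := by
      rw [Algebra.coe_norm_int]
      have := Algebra.PowerBasis.norm_gen_eq_coeff_zero_minpoly pb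
      rw [AdjoinRoot.powerBasis_gen, AdjoinRoot.powerBasis_dim, AdjoinRoot.minpoly_root hirrQ.ne_zero,
        hmQ.leadingCoeff] at this
      rw [hf.natDegree_map, inv_one, C_1, mul_one, coeff_map] at this
      exact this
    have h2 : Algebra.norm ℤ α = (-1) ^ f.natDegree * f.coeff 0 := by exact_mod_cast h1
    rw [h2, Int.natAbs_mul]
    simp [Int.natAbs_pow]

lemma natCast_mem_iff_under {K : Type*} [Field K] [NumberField K] {p : ℕ} {P : Ideal (𝓞 K)}
    (h : P.under ℤ = Ideal.span {(p : ℤ)}) : (p : 𝓞 K) ∈ P := by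
  have h1 : (p : ℤ) ∈ P.under ℤ := h ▸ Ideal.mem_span_singleton_self _
  simpa [Ideal.under_def, Ideal.mem_comap] using h1

lemma exists_emultiplicity_eq {K : Type*} [Field K] [NumberField K] {P : Ideal (𝓞 K)}
    (hP : Prime P) {a : 𝓞 K} (ha : a ≠ 0) :
    ∃ x : ℕ, emultiplicity P (Ideal.span {a}) = x := by
  have : FiniteMultiplicity P (Ideal.span {a}) :=
    FiniteMultiplicity.of_prime_left hP (by simpa using ha)
  exact ⟨_, this.emultiplicity_eq_multiplicity⟩

/-- The places of a stem field of `f` above `p`, with ramification indices `e i` and residue degrees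
`r i`. -/
theorem sum_places (hf : f.Monic) (hirr : Irreducible f) (hfG : f ∣ G)
    (hG0 : G.coeff 0 ≠ 0) {p : ℕ} (hp : p.Prime) :
    ∃ (ι : Type) (_ : Fintype ι) (e r x : ι → ℕ), ∑ i, e i * r i = f.natDegree ∧
      (∀ i, 0 < e i) ∧ (∀ i, 0 < r i) ∧ (∀ i, IsNewtonSlope G p (e i) (x i)) ∧
      ((p : ℤ) ∣ f.coeff 0 → ∃ i, 0 < x i) := by
  obtain ⟨K, _, _, α, hα, hdeg, hnorm⟩ := exists_numberField_root hf hirr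
  have hαG : aeval α G = 0 := by
    obtain ⟨g, rfl⟩ := hfG
    rw [map_mul, hα, zero_mul]
  have hα0 : α ≠ 0 := by
    rintro rfl
    rw [aeval_def, eval₂_at_zero] at hαG
    exact hG0 (by simpa using hαG)
  have hpne : (p : 𝓞 K) ≠ 0 := Nat.cast_ne_zero.mpr hp.ne_zero
  let I : Ideal ℤ := Ideal.span {(p : ℤ)}
  have hIp : I.IsPrime := (Ideal.span_singleton_prime (by exact_mod_cast hp.ne_zero)).mpr
    (Nat.prime_iff_prime_int.mp hp)
  have hIbot : I ≠ ⊥ := by simp [I, hp.ne_zero]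
  have hImax : I.IsMaximal := hIp.isMaximal hIbot
  have hmap : I.map (algebraMap ℤ (𝓞 K)) = Ideal.span {(p : 𝓞 K)} := by
    simp [I, Ideal.map_span]
  let hfin : Fintype (I.primesOver (𝓞 K)) := (IsDedekindDomain.primesOver_finite I (𝓞 K)).fintype
  have hprime (Q : I.primesOver (𝓞 K)) : Prime Q.1 := by
    have := Q.2.1
    have := Q.2.2
    exact Ideal.prime_of_isPrime (Ideal.ne_bot_of_liesOver_of_ne_bot hIbot Q.1) Q.2.1
  choose x hx using fun Q : I.primesOver (𝓞 K) => exists_emultiplicity_eq (hprime Q) hα0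
  refine ⟨I.primesOver (𝓞 K), hfin, fun Q => Q.1.ramificationIdx ℤ, fun Q => Q.1.inertiaDeg ℤ,
    x, ?_, fun Q => ?_, fun Q => ?_, fun Q => ?_, fun h => ?_⟩
  · rw [Ideal.sum_ramification_inertia_eq_finrank, hdeg]
  · have := Q.2.1
    exact Ideal.ramificationIdx_pos Q.1 ℤ
  · have := Q.2.1
    exact Ideal.inertiaDeg_pos Q.1 ℤ
  · have := Q.2.1
    have := Q.2.2
    refine isNewtonSlope_of_aeval_eq_zero (hprime Q) hp
      (natCast_mem_iff_under (Q.2.2.over.symm)) hαG ?_ (hx Q)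
    obtain ⟨k, hk⟩ := exists_emultiplicity_eq (hprime Q) hpne
    beta_reduce
    rw [Ideal.IsDedekindDomain.ramificationIdx_eq_multiplicity I Q.1
      (by rw [hmap]; simpa using hp.ne_zero), hmap, hk, multiplicity_eq_of_emultiplicity_eq_some hk]
  · obtain ⟨P, hPmax, hPu, hPdvd⟩ := Ideal.exists_isMaximal_dvd_of_dvd_absNorm' hp
      (Ideal.span {α}) (by
        rw [Ideal.absNorm_span_singleton, hnorm]
        exact Int.natCast_dvd.mp h)
    let Q : I.primesOver (𝓞 K) := ⟨P, hPmax.isPrime, ⟨hPu.symm⟩⟩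
    refine ⟨Q, ?_⟩
    have h1 := hx Q
    have h2 : emultiplicity P (Ideal.span {α}) ≠ 0 := by
      rw [Ne, emultiplicity_eq_zero, not_not]
      exact hPdvd
    rw [h1] at h2
    exact Nat.pos_of_ne_zero (by exact_mod_cast h2)

theorem dvd_natDegree_of_newtonSlope (hf : f.Monic) (hirr : Irreducible f) (hfG : f ∣ G)
    (hG0 : G.coeff 0 ≠ 0) {p : ℕ} (hp : p.Prime) (q : ℕ)
    (h : ∀ e x, 0 < e → e ≤ f.natDegree → IsNewtonSlope G p e x → q ∣ e) : q ∣ f.natDegree := by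
  obtain ⟨ι, _, e, r, x, hsum, he, hr, hs, -⟩ := sum_places hf hirr hfG hG0 hp
  have hle (i : ι) : e i ≤ f.natDegree := hsum ▸ (Nat.le_mul_of_pos_right _ (hr i)).trans
    (Finset.single_le_sum (f := fun i => e i * r i) (fun _ _ => Nat.zero_le _) (Finset.mem_univ i))
  rw [← hsum]
  exact Finset.dvd_sum fun i _ => (h _ _ (he i) (hle i) (hs i)).mul_right _

theorem exists_newtonSlope_of_dvd_coeff_zero (hf : f.Monic) (hirr : Irreducible f) (hfG : f ∣ G)
    (hG0 : G.coeff 0 ≠ 0) {p : ℕ} (hp : p.Prime) (hp0 : (p : ℤ) ∣ f.coeff 0) :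
    ∃ e x, 0 < e ∧ e ≤ f.natDegree ∧ 0 < x ∧ IsNewtonSlope G p e x := by
  obtain ⟨ι, _, e, r, x, hsum, he, hr, hs, hx⟩ := sum_places hf hirr hfG hG0 hp
  have hle (i : ι) : e i ≤ f.natDegree := hsum ▸ (Nat.le_mul_of_pos_right _ (hr i)).trans
    (Finset.single_le_sum (f := fun i => e i * r i) (fun _ _ => Nat.zero_le _) (Finset.mem_univ i))
  obtain ⟨i, hi⟩ := hx hp0
  exact ⟨e i, x i, he i, hle i, hi, hs i⟩

/-- If `p` divides the coefficients of `G` up to degree `G.natDegree - f.natDegree` and `p` does not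
divide `f 0`, then `f` cannot divide `G`. -/
theorem dvd_coeff_zero_of_dvd_coeff (hf : f.Monic) (hfG : f ∣ G) (hG : G.Monic) {p : ℕ}
    (hp : p.Prime) (hle : f.natDegree ≤ G.natDegree)
    (hdvd : ∀ j ≤ G.natDegree - f.natDegree, (p : ℤ) ∣ G.coeff j) : (p : ℤ) ∣ f.coeff 0 := by
  have := Fact.mk hp
  by_contra hcon
  let φ := Int.castRingHom (ZMod p)
  set m := G.natDegree - f.natDegree
  have h1 : (X : (ZMod p)[X]) ^ (m + 1) ∣ G.map φ := by
    rw [X_pow_dvd_iff]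
    intro j hj
    rw [coeff_map]
    exact (ZMod.intCast_zmod_eq_zero_iff_dvd _ _).mpr (hdvd j (by omega))
  have hcop : IsCoprime ((X : (ZMod p)[X]) ^ (m + 1)) (f.map φ) := by
    refine IsCoprime.pow_left ((irreducible_X.coprime_iff_not_dvd).mpr ?_)
    rw [X_dvd_iff, coeff_map]
    exact fun h => hcon ((ZMod.intCast_zmod_eq_zero_iff_dvd _ _).mp h)
  have h2 := hcop.mul_dvd h1 (Polynomial.map_dvd φ hfG)
  have h3 := natDegree_le_of_dvd h2 (hG.map φ).ne_zero
  rw [(monic_X_pow _).natDegree_mul (hf.map φ), natDegree_X_pow, hf.natDegree_map,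
    hG.natDegree_map] at h3
  omega
end NumberField

section DigitSum

variable {p : ℕ}

lemma sum_digits_mul_add (hp : 1 < p) (a : ℕ) {b : ℕ} (hb : b < p) :
    (p.digits (p * a + b)).sum = (p.digits a).sum + b := by
  rcases Nat.eq_zero_or_pos (p * a + b) with h | h
  · have h1 : p * a = 0 := by omega
    have h2 : a = 0 := by
      rcases Nat.mul_eq_zero.mp h1 with h | h <;> omega
    have h3 : b = 0 := by omega
    simp [h2, h3]
  · rw [Nat.digits_def' hp h, List.sum_cons, Nat.mul_add_mod, Nat.mod_eq_of_lt hb,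
      Nat.mul_add_div (by omega), Nat.div_eq_of_lt hb, add_zero, add_comm]

lemma sum_digits_eq (hp : 1 < p) (r : ℕ) :
    (p.digits r).sum = (p.digits (r / p)).sum + r % p := by
  conv_lhs => rw [← Nat.div_add_mod r p]
  exact sum_digits_mul_add hp _ (Nat.mod_lt _ (by omega))

lemma sum_digits_pow_mul_add (hp : 1 < p) (L q : ℕ) {r : ℕ} (hr : r < p ^ L) :
    (p.digits (p ^ L * q + r)).sum = (p.digits q).sum + (p.digits r).sum := by
  induction L generalizing r with
  | zero =>
    have : r = 0 := by simpa using hr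
    simp [this]
  | succ L ih =>
    have h1 : p ^ (L + 1) * q + r = p * (p ^ L * q + r / p) + r % p := by
      have := Nat.div_add_mod r p
      rw [pow_succ', mul_add, ← mul_assoc, add_assoc, this]
    have h2 : r / p < p ^ L := by
      rw [Nat.div_lt_iff_lt_mul (by omega)]
      rwa [pow_succ] at hr
    rw [h1, sum_digits_mul_add hp _ (Nat.mod_lt _ (by omega)), ih h2, sum_digits_eq hp r, add_assoc]

lemma le_pow_mul_sum_digits (hp : 1 < p) (k : ℕ) {r : ℕ} (hr : r < p ^ (k + 1)) :
    r ≤ p ^ k * (p.digits r).sum := by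
  induction k generalizing r with
  | zero =>
    rw [sum_digits_eq hp r]
    simp only [zero_add, pow_one] at hr
    rw [Nat.div_eq_of_lt hr, Nat.mod_eq_of_lt hr]
    simp
  | succ k ih =>
    have h2 : r / p < p ^ (k + 1) := by
      rw [Nat.div_lt_iff_lt_mul (by omega)]
      rwa [pow_succ] at hr
    have h3 := Nat.mul_le_mul_left p (ih h2)
    have h4 : r % p ≤ p ^ (k + 1) * (r % p) := Nat.le_mul_of_pos_left _ (by positivity)
    rw [sum_digits_eq hp r]
    calc r = p * (r / p) + r % p := (Nat.div_add_mod r p).symm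
      _ ≤ p * (p ^ k * (p.digits (r / p)).sum) + p ^ (k + 1) * (r % p) := by omega
      _ = _ := by ring

lemma sum_digits_pos (hp : 1 < p) {r : ℕ} (hr : 0 < r) : 0 < (p.digits r).sum := by
  obtain ⟨k, hk⟩ : ∃ k, r < p ^ (k + 1) :=
    ⟨r, (Nat.lt_pow_self hp).trans (Nat.pow_lt_pow_right hp (by omega))⟩
  have := le_pow_mul_sum_digits hp k hk
  by_contra h
  rw [Nat.eq_zero_of_not_pos h] at this
  omega

lemma legendre_formula (hp : p.Prime) (n : ℕ) :
    (p - 1 : ℤ) * padicValNat p n.factorial = n - (p.digits n).sum := by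
  have := Fact.mk hp
  have h := sub_one_mul_padicValNat_factorial (p := p) n
  have h1 := Nat.digit_sum_le p n
  have h2 := hp.one_le
  have h3 : (((p - 1) * padicValNat p n.factorial : ℕ) : ℤ) = ((n - (p.digits n).sum : ℕ) : ℤ) :=
    congrArg _ h
  rwa [Nat.cast_mul, Nat.cast_sub h1, Nat.cast_sub h2, Nat.cast_one] at h3

lemma padicValNat_add_choose (hp : p.Prime) (n s : ℕ) :
    (p - 1 : ℤ) * padicValNat p ((n + s).choose s) =
      (p.digits n).sum + (p.digits s).sum - (p.digits (n + s)).sum := by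
  have := Fact.mk hp
  have h := Nat.add_choose_mul_factorial_mul_factorial n s
  have hc : (n + s).choose s ≠ 0 := (Nat.choose_pos (by omega)).ne'
  have h2 : padicValNat p ((n + s).choose s) + padicValNat p n.factorial
      + padicValNat p s.factorial = padicValNat p (n + s).factorial := by
    rw [← h, padicValNat.mul (mul_ne_zero hc (Nat.factorial_ne_zero _)) (Nat.factorial_ne_zero _),
      padicValNat.mul hc (Nat.factorial_ne_zero _)]
  have h3 := legendre_formula hp n
  have h4 := legendre_formula hp s
  have h5 := legendre_formula hp (n + s)
  rw [← h2] at h5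
  simp only [Nat.cast_add] at h5
  linear_combination h5 - h3 - h4

lemma sum_digits_add_le (hp : p.Prime) (a b : ℕ) :
    (p.digits (a + b)).sum ≤ (p.digits a).sum + (p.digits b).sum := by
  have h := padicValNat_add_choose hp a b
  have h1 : (0 : ℤ) ≤ (p - 1 : ℤ) * padicValNat p ((a + b).choose b) :=
    mul_nonneg (by have := hp.one_le; omega) (by positivity)
  omega

lemma padicValNat_choose_mod_pow (hp : p.Prime) {n s : ℕ} (h : ¬ p ∣ (n + s).choose s) (L : ℕ) :
    padicValNat p ((n % p ^ L + s).choose s) = 0 := by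
  have h0 := padicValNat_add_choose hp n s
  rw [padicValNat.eq_zero_of_not_dvd h] at h0
  have h1 := padicValNat_add_choose hp (n % p ^ L) s
  have hlt : n % p ^ L < p ^ L := Nat.mod_lt _ (pow_pos hp.pos _)
  have h2 := sum_digits_pow_mul_add hp.one_lt L (n / p ^ L) hlt
  have h3 := sum_digits_pow_mul_add hp.one_lt L (n / p ^ L) (r := 0) (pow_pos hp.pos _)
  have h4 := sum_digits_add_le hp (p ^ L * (n / p ^ L) + 0) (n % p ^ L + s)
  have h5 : p ^ L * (n / p ^ L) + 0 + (n % p ^ L + s) = n + s := by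
    have := Nat.div_add_mod n (p ^ L)
    omega
  rw [Nat.div_add_mod] at h2
  rw [h5] at h4
  simp only [Nat.digits_zero, List.sum_nil] at h3
  have h6 := hp.two_le
  have h7 : (p - 1 : ℤ) * padicValNat p ((n % p ^ L + s).choose s) ≤ 0 := by
    rw [Nat.cast_zero, mul_zero] at h0
    omega
  have h8 : ((padicValNat p ((n % p ^ L + s).choose s) : ℕ) : ℤ) ≤ 0 := by
    by_contra hcon
    have : (0 : ℤ) < (p - 1 : ℤ) * padicValNat p ((n % p ^ L + s).choose s) :=
      mul_pos (by omega) (by omega)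
    omega
  omega

end DigitSum

section Coefficients

/-- The coefficients of `g1 n s`. -/
def g1Coeff (n s j : ℕ) : ℕ := n.descFactorial (n - j) * (n - j + s).choose s

/-- `g1 n s` as a polynomial with integer coefficients. -/
noncomputable def intG1 (n s : ℕ) : ℤ[X] :=
  ∑ j ∈ Finset.range (n + 1), Polynomial.C (g1Coeff n s j : ℤ) * Polynomial.X ^ j

lemma g1Coeff_pos (n s j : ℕ) : 0 < g1Coeff n s j :=
  Nat.mul_pos (Nat.descFactorial_pos.mpr (Nat.sub_le _ _)) (Nat.choose_pos (by omega))

lemma coeff_intG1 (n s j : ℕ) : (intG1 n s).coeff j = if j ≤ n then (g1Coeff n s j : ℤ) else 0 := by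
  simp only [intG1, finsetSum_coeff, coeff_C_mul_X_pow, Finset.sum_ite_eq, Finset.mem_range,
    Nat.lt_succ_iff]

lemma coeff_intG1_ne_zero {n s j : ℕ} : (intG1 n s).coeff j ≠ 0 ↔ j ≤ n := by
  have := g1Coeff_pos n s j
  rw [coeff_intG1]
  split_ifs with h
  · simp [h]
    omega
  · simp [h]

lemma monic_intG1 (n s : ℕ) : (intG1 n s).Monic := by
  refine monic_of_natDegree_le_of_coeff_eq_one n ?_ ?_
  · rw [natDegree_le_iff_coeff_eq_zero]
    intro j hj
    rw [coeff_intG1, if_neg (by omega)]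
  · simp [coeff_intG1, g1Coeff]

lemma natDegree_intG1 (n s : ℕ) : (intG1 n s).natDegree = n := by
  refine le_antisymm ?_ (le_natDegree_of_ne_zero (coeff_intG1_ne_zero.mpr le_rfl))
  rw [natDegree_le_iff_coeff_eq_zero]
  intro j hj
  rw [coeff_intG1, if_neg (by omega)]

lemma padicValInt_coeff_intG1 {p : ℕ} (hp : p.Prime) {n j : ℕ} (s : ℕ) (hj : j ≤ n) :
    (p - 1 : ℤ) * padicValInt p ((intG1 n s).coeff j) = n - (p.digits n).sum - j
      + (p.digits j).sum + (p - 1) * padicValNat p ((n - j + s).choose s) := by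
  have := Fact.mk hp
  have hd : n.descFactorial (n - j) ≠ 0 := (Nat.descFactorial_pos.mpr (Nat.sub_le _ _)).ne'
  rw [coeff_intG1, if_pos hj, padicValInt.of_nat, g1Coeff, padicValNat.mul hd
    (Nat.choose_pos (by omega)).ne']
  have h := Nat.factorial_mul_descFactorial (Nat.sub_le n j)
  rw [Nat.sub_sub_self hj] at h
  have h2 : padicValNat p j.factorial + padicValNat p (n.descFactorial (n - j)) =
      padicValNat p n.factorial := by
    rw [← h, padicValNat.mul (Nat.factorial_ne_zero _) hd]
  have h3 := legendre_formula hp n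
  have h4 := legendre_formula hp j
  rw [← h2] at h3
  simp only [Nat.cast_add] at h3 ⊢
  linear_combination h3 - h4

/-- The `p`-adic Newton polygon slopes of `g1 n s` when `p` does not divide `(n + s).choose s`. -/
theorem newtonSlope_intG1 {p : ℕ} (hp : p.Prime) {n s : ℕ} (hC : ¬ p ∣ (n + s).choose s) {e x : ℕ}
    (he : 0 < e) (hN : IsNewtonSlope (intG1 n s) p e x) :
    ∃ l, (x : ℤ) * (p - 1) * p ^ l = e * (p ^ l - 1) ∧ ∀ m, p ^ m ∣ n → m ≤ l := by
  have hp1 := hp.one_lt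
  set S : ℕ → ℕ := fun j => (p.digits j).sum with hS
  set c : ℕ → ℕ := fun j => padicValNat p ((n - j + s).choose s) with hc
  set δ : ℤ := e - (p - 1) * x with hδ
  have key (j : ℕ) (hj : j ≤ n) : ∃ i ≤ n, i ≠ j ∧
      (e * S i - δ * i + (p - 1) * e * c i : ℤ) ≤ e * S j - δ * j + (p - 1) * e * c j := by
    obtain ⟨i, hij, hi, hle⟩ := hN j (coeff_intG1_ne_zero.mpr hj)
    rw [coeff_intG1_ne_zero] at hi
    refine ⟨i, hi, hij, ?_⟩
    have h1 := padicValInt_coeff_intG1 hp s hi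
    have h2 := padicValInt_coeff_intG1 hp s hj
    zify at hle
    have h3 := mul_le_mul_of_nonneg_left hle (show (0 : ℤ) ≤ p - 1 by omega)
    simp only [hS, hc, hδ]
    linear_combination h3 - e * h1 + e * h2
  have hc0 : c 0 = 0 := padicValNat.eq_zero_of_not_dvd (by simpa using hC)
  have hcnn (i : ℕ) : (0 : ℤ) ≤ (p - 1) * e * c i :=
    mul_nonneg (mul_nonneg (by omega) (by omega)) (by omega)
  have hδ0 : 0 < δ := by
    by_contra! hcon
    obtain ⟨i, -, hi0, hle⟩ := key 0 (Nat.zero_le _)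
    have h1 : 0 < S i := sum_digits_pos hp1 (Nat.pos_of_ne_zero hi0)
    have h2 : (0 : ℤ) < e * S i := by positivity
    have h3 : δ * i ≤ 0 := mul_nonpos_of_nonpos_of_nonneg hcon (by omega)
    have h4 := hcnn i
    rw [hc0] at hle
    simp [hS] at hle h2
    omega
  have hδe : δ ≤ e := by
    have : (0 : ℤ) ≤ (p - 1) * x := mul_nonneg (by omega) (by omega)
    omega
  obtain ⟨k, hk1, hk2⟩ : ∃ k : ℕ, δ * p ^ k ≤ e ∧ e < δ * p ^ (k + 1) := by
    have hex : ∃ L : ℕ, (e : ℤ) < δ * p ^ L := by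
      refine ⟨e, ?_⟩
      have h1 : (e : ℤ) < (p : ℤ) ^ e := by exact_mod_cast Nat.lt_pow_self hp1
      nlinarith
    classical
    have h1 := Nat.find_spec hex
    have h2 : Nat.find hex ≠ 0 := fun h0 => by
      rw [h0] at h1
      simp at h1
      omega
    obtain ⟨k, hk⟩ := Nat.exists_eq_succ_of_ne_zero h2
    refine ⟨k, ?_, by rwa [hk] at h1⟩
    have := Nat.find_min hex (m := k) (by omega)
    simpa using this
  have main : ¬ (δ * p ^ k < e ∨ p ^ (k + 1) ∣ n) := by
    intro hor
    set T := p ^ (k + 1) with hT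
    have hTpos : 0 < T := pow_pos hp.pos _
    have hψ (q : ℕ) : (e * S (q + 1) - δ * (T * (q + 1 : ℕ)) : ℤ) < e * S q - δ * (T * q) := by
      have h1 : S (q + 1) ≤ S q + 1 := by
        have := sum_digits_add_le hp q 1
        have h1 : (p.digits 1).sum = 1 := by
          rw [Nat.digits_of_lt p 1 one_ne_zero hp1]
          rfl
        simp only [hS]
        omega
      have h2 : (e * S (q + 1) : ℤ) ≤ e * (S q + 1) :=
        mul_le_mul_of_nonneg_left (by exact_mod_cast h1) (by omega)
      have h3 : (e : ℤ) < δ * T := by rw [hT]; exact_mod_cast hk2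
      push_cast
      nlinarith
    have hanti : StrictAnti fun q : ℕ => (e * S q - δ * (T * q) : ℤ) :=
      strictAnti_nat_of_succ_lt hψ
    have hlow (r : ℕ) (hr : r < T) : δ * r ≤ δ * p ^ k * S r := by
      have h1 : r ≤ p ^ k * S r := le_pow_mul_sum_digits hp1 k hr
      have h2 : (r : ℤ) ≤ p ^ k * S r := by exact_mod_cast h1
      nlinarith
    have hdm := Nat.div_add_mod n T
    have hmodlt := Nat.mod_lt n hTpos
    obtain ⟨i, hi, hne, hle⟩ := key (T * (n / T)) (by omega)
    have hcj : c (T * (n / T)) = 0 := by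
      have h1 : n - T * (n / T) = n % T := by omega
      simp only [hc, h1]
      exact padicValNat_choose_mod_pow hp hC _
    have hSsplit (q r : ℕ) (hr : r < T) : S (T * q + r) = S q + S r :=
      sum_digits_pow_mul_add hp1 (k + 1) q hr
    have hSj : S (T * (n / T)) = S (n / T) := by
      have := hSsplit (n / T) 0 hTpos
      simpa [hS] using this
    have hidm := Nat.div_add_mod i T
    have himod := Nat.mod_lt i hTpos
    have hSi := hSsplit (i / T) (i % T) himod
    rw [hidm] at hSi
    have hqle : i / T ≤ n / T := Nat.div_le_div_right hi
    have hiz : (i : ℤ) = T * (i / T : ℕ) + (i % T : ℕ) := by exact_mod_cast hidm.symm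
    have h4 := hcnn i
    have h5 := hlow _ himod
    have h6 : δ * p ^ k * S (i % T) ≤ e * S (i % T) := mul_le_mul_of_nonneg_right hk1 (by omega)
    have h7 := hanti.antitone hqle
    have h8 : (e * S i - δ * i + (p - 1) * e * c i : ℤ) ≤ e * S (n / T) - δ * (T * (n / T : ℕ)) := by
      rw [hcj, hSj] at hle
      simp only [Nat.cast_zero, Nat.cast_mul, mul_zero, add_zero] at hle
      exact hle
    rw [hSi, hiz] at h8
    simp only [Nat.cast_add] at h8
    rcases hqle.lt_or_eq with hlt | heq
    · have h9 := hanti hlt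
      simp only at h9
      linarith
    · rw [heq] at h8
      have hr0 : 0 < i % T := by
        rw [heq] at hidm
        omega
      have hTn : ¬ T ∣ n := fun hd => by
        have := Nat.mod_eq_zero_of_dvd hd
        rw [heq] at hidm
        omega
      have hlt : δ * p ^ k < e := hor.resolve_right hTn
      have hSpos : 0 < S (i % T) := sum_digits_pos hp1 hr0
      have h9 : δ * p ^ k * S (i % T) < e * S (i % T) :=
        mul_lt_mul_of_pos_right hlt (by exact_mod_cast hSpos)
      linarith
  push Not at main
  have heq : δ * p ^ k = e := le_antisymm hk1 main.1
  refine ⟨k, ?_, fun m hm => ?_⟩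
  · rw [hδ] at heq
    linear_combination -heq
  · by_contra! hcon
    exact main.2 ((pow_dvd_pow p hcon).trans hm)

variable {f : ℤ[X]}

/-- A power of a prime `p` not dividing `(n + s).choose s` that divides `n` also divides the degree
of every irreducible factor of `g1 n s`. -/
theorem pow_dvd_natDegree (hf : f.Monic) (hirr : Irreducible f) {n s : ℕ} (hfG : f ∣ intG1 n s)
    {p : ℕ} (hp : p.Prime) (hC : ¬ p ∣ (n + s).choose s) {m : ℕ} (hm : p ^ m ∣ n) :
    p ^ m ∣ f.natDegree := by
  refine dvd_natDegree_of_newtonSlope hf hirr hfG (coeff_intG1_ne_zero.mpr (Nat.zero_le _)) hp _ ?_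
  intro e x he _ hN
  obtain ⟨l, hl, hml⟩ := newtonSlope_intG1 hp hC he hN
  have h1 : (p : ℤ) ^ l ∣ e * (p ^ l - 1) := ⟨x * (p - 1), by rw [← hl]; ring⟩
  have h2 : IsCoprime ((p : ℤ) ^ l) (p ^ l - 1) := ⟨1, -1, by ring⟩
  have h3 : p ^ l ∣ e := by exact_mod_cast h2.dvd_of_dvd_mul_right h1
  exact (pow_dvd_pow p (hml m hm)).trans h3

lemma dvd_g1Coeff {p n d i s : ℕ} (hid : i < d) (hpn : p ∣ n - i) {j : ℕ} (hj : j + d ≤ n) :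
    p ∣ g1Coeff n s j := by
  refine Dvd.dvd.mul_right ?_ _
  rw [Nat.descFactorial_eq_prod_range]
  exact hpn.trans (Finset.dvd_prod_of_mem _ (Finset.mem_range.mpr (by omega)))

theorem dvd_coeff_zero_of_dvd_g1Coeff (hf : f.Monic) {n s : ℕ} (hfG : f ∣ intG1 n s)
    {p : ℕ} (hp : p.Prime) (h : ∀ j, j + f.natDegree ≤ n → p ∣ g1Coeff n s j) :
    (p : ℤ) ∣ f.coeff 0 := by
  have hle : f.natDegree ≤ (intG1 n s).natDegree :=
    natDegree_le_of_dvd hfG (monic_intG1 n s).ne_zero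
  refine dvd_coeff_zero_of_dvd_coeff hf hfG (monic_intG1 n s) hp hle fun j hj => ?_
  rw [natDegree_intG1] at hj hle
  rw [coeff_intG1, if_pos (by omega)]
  exact_mod_cast h j (by omega)

/-- There is no irreducible factor of degree `d` when a prime `p > d` not dividing `(n + s).choose s`
divides one of `n, n - 1, …, n - d + 1`. -/
theorem not_dvd_of_prime_dvd_sub (hf : f.Monic) (hirr : Irreducible f) {n s : ℕ}
    (hfG : f ∣ intG1 n s) {p : ℕ} (hp : p.Prime) (hC : ¬ p ∣ (n + s).choose s)
    (hd : f.natDegree < p) {i : ℕ} (hi : i < f.natDegree) (hpn : p ∣ n - i) : False := by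
  have h0 := dvd_coeff_zero_of_dvd_g1Coeff hf hfG hp fun j hj => dvd_g1Coeff (s := s) hi hpn hj
  obtain ⟨e, x, he, hed, hx, hN⟩ := exists_newtonSlope_of_dvd_coeff_zero hf hirr hfG
    (coeff_intG1_ne_zero.mpr (Nat.zero_le _)) hp h0
  obtain ⟨l, hl, -⟩ := newtonSlope_intG1 hp hC he hN
  have hp1 := hp.two_le
  rcases Nat.eq_zero_or_pos l with rfl | hl0
  · have : (x : ℤ) * (p - 1) = 0 := by simpa using hl
    rcases mul_eq_zero.mp this with h | h <;> omega
  · have h1 : (p : ℤ) ^ l ∣ e * (p ^ l - 1) := ⟨x * (p - 1), by rw [← hl]; ring⟩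
    have h2 : IsCoprime ((p : ℤ) ^ l) (p ^ l - 1) := ⟨1, -1, by ring⟩
    have h3 : p ^ l ∣ e := by exact_mod_cast h2.dvd_of_dvd_mul_right h1
    have h4 := Nat.le_of_dvd he ((dvd_pow_self p hl0.ne').trans h3)
    omega

end Coefficients

section LargePrimes

open Nat in
lemma choose_le_of_prime_factors_le {n k y c : ℕ} (hk : k ≤ n) (hn : 0 < n) (hy : Nat.sqrt n ≤ y)
    (hc : ∀ p, p ^ 3 ≤ n → p ≤ c)
    (hp : ∀ p, p.Prime → p ∣ n.choose k → p ≤ y ∨ (k < p ∧ p ≤ k + 7)) :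
    n.choose k ≤ primorial y * (k + 7) ^ 7 * primorial (Nat.sqrt n) * n ^ c := by
  let f₁ : ℕ → ℕ := fun p => if p ∈ primesLE y then p else 1
  let f₂ : ℕ → ℕ := fun p => if p ∈ Finset.Ioc k (k + 7) then k + 7 else 1
  let f₃ : ℕ → ℕ := fun p => if p ∈ primesLE (Nat.sqrt n) then p else 1
  let f₄ : ℕ → ℕ := fun p => if p ∈ Finset.Icc 1 c then n else 1
  have h₁ (p : ℕ) : 1 ≤ f₁ p := by
    simp only [f₁]
    split_ifs with h
    · exact (prime_of_mem_primesLE h).one_le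
    · rfl
  have h₂ (p : ℕ) : 1 ≤ f₂ p := by
    simp only [f₂]
    split_ifs <;> omega
  have h₃ (p : ℕ) : 1 ≤ f₃ p := by
    simp only [f₃]
    split_ifs with h
    · exact (prime_of_mem_primesLE h).one_le
    · rfl
  have h₄ (p : ℕ) : 1 ≤ f₄ p := by
    simp only [f₄]
    split_ifs <;> omega
  have key (p : ℕ) : p ^ (n.choose k).factorization p ≤ f₁ p * f₂ p * f₃ p * f₄ p := by
    by_cases hv : (n.choose k).factorization p = 0
    · rw [hv, pow_zero]
      exact Nat.mul_pos (Nat.mul_pos (Nat.mul_pos (h₁ p) (h₂ p)) (h₃ p)) (h₄ p)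
    have hmem : p ∈ (n.choose k).primeFactors := by
      rw [← Nat.support_factorization, Finsupp.mem_support_iff]
      exact hv
    have hpp := Nat.prime_of_mem_primeFactors hmem
    have hle := Nat.pow_factorization_choose_le (p := p) (k := k) hn
    by_cases h3 : p ^ 3 ≤ n
    · have : f₄ p = n := if_pos (Finset.mem_Icc.mpr ⟨hpp.one_le, hc p h3⟩)
      rw [this]
      exact hle.trans (Nat.le_mul_of_pos_left _
        (Nat.mul_pos (Nat.mul_pos (h₁ p) (h₂ p)) (h₃ p)))
    by_cases h2 : p ^ 2 ≤ n
    · have hs : p ≤ Nat.sqrt n := Nat.le_sqrt'.mpr h2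
      have e1 : f₁ p = p := if_pos (mem_primesLE.mpr ⟨hs.trans hy, hpp⟩)
      have e3 : f₃ p = p := if_pos (mem_primesLE.mpr ⟨hs, hpp⟩)
      have hv2 : (n.choose k).factorization p ≤ 2 := by
        by_contra! hcon
        exact h3 ((Nat.pow_le_pow_right hpp.pos hcon).trans hle)
      calc p ^ (n.choose k).factorization p ≤ p ^ 2 := Nat.pow_le_pow_right hpp.pos hv2
        _ = p * 1 * p * 1 := by ring
        _ ≤ f₁ p * f₂ p * f₃ p * f₄ p := by
          rw [e1, e3]
          gcongr
          · exact h₂ p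
          · exact h₄ p
    · have hv1 : (n.choose k).factorization p ≤ 1 := Nat.factorization_choose_le_one (by omega)
      have hpf : p ≤ f₁ p * f₂ p := by
        rcases hp p hpp (Nat.dvd_of_mem_primeFactors hmem) with h | h
        · have e1 : f₁ p = p := if_pos (mem_primesLE.mpr ⟨h, hpp⟩)
          rw [e1]
          exact Nat.le_mul_of_pos_right _ (h₂ p)
        · have e2 : f₂ p = k + 7 := if_pos (Finset.mem_Ioc.mpr h)
          rw [e2]
          exact h.2.trans (Nat.le_mul_of_pos_left _ (h₁ p))
      calc p ^ (n.choose k).factorization p ≤ p ^ 1 := Nat.pow_le_pow_right hpp.pos hv1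
        _ = p * 1 * 1 := by ring
        _ ≤ f₁ p * f₂ p * f₃ p * f₄ p := by
          gcongr
          · exact h₃ p
          · exact h₄ p
  have hprod (s : Finset ℕ) (g : ℕ → ℕ) (hg : ∀ p ∈ s, 1 ≤ g p) :
      ∏ p ∈ Finset.range (n + 1), (if p ∈ s then g p else 1) ≤ ∏ p ∈ s, g p := by
    rw [← Finset.prod_filter]
    exact Finset.prod_le_prod_of_subset_of_one_le' (fun p hp => (Finset.mem_filter.mp hp).2)
      (fun p hp _ => hg p hp)
  calc n.choose k = ∏ p ∈ Finset.range (n + 1), p ^ (n.choose k).factorization p :=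
        (Nat.prod_pow_factorization_choose n k hk).symm
    _ ≤ ∏ p ∈ Finset.range (n + 1), (f₁ p * f₂ p * f₃ p * f₄ p) :=
        Finset.prod_le_prod' fun p _ => key p
    _ = (∏ p ∈ Finset.range (n + 1), f₁ p) * (∏ p ∈ Finset.range (n + 1), f₂ p) *
        (∏ p ∈ Finset.range (n + 1), f₃ p) * (∏ p ∈ Finset.range (n + 1), f₄ p) := by
        simp only [Finset.prod_mul_distrib]
    _ ≤ primorial y * (k + 7) ^ 7 * primorial (Nat.sqrt n) * n ^ c := by
        gcongr
        · exact hprod _ _ fun p h => (prime_of_mem_primesLE h).one_le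
        · exact (hprod _ _ fun p _ => by omega).trans (by simp)
        · exact hprod _ _ fun p h => (prime_of_mem_primesLE h).one_le
        · exact (hprod _ _ fun p _ => hn).trans (by simp)

lemma pow_le_pow_mul_choose {n k : ℕ} (h : k ≤ n) : n ^ k ≤ k ^ k * n.choose k := by
  induction k generalizing n with
  | zero => simp
  | succ k ih =>
    obtain ⟨m, rfl⟩ := Nat.exists_eq_succ_of_ne_zero (show n ≠ 0 by omega)
    rw [Nat.succ_eq_add_one] at *
    have h1 := ih (n := m) (by omega)
    have h2 : ((m + 1) * k) ^ k ≤ (m * (k + 1)) ^ k := Nat.pow_le_pow_left (by nlinarith) k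
    have h3 : (m + 1) ^ k ≤ (k + 1) ^ k * m.choose k := by
      rcases Nat.eq_zero_or_pos k with rfl | hk
      · simp
      have : k ^ k * (m + 1) ^ k ≤ k ^ k * ((k + 1) ^ k * m.choose k) := by
        calc k ^ k * (m + 1) ^ k = ((m + 1) * k) ^ k := by rw [mul_pow, mul_comm]
          _ ≤ (m * (k + 1)) ^ k := h2
          _ = m ^ k * (k + 1) ^ k := mul_pow _ _ _
          _ ≤ k ^ k * m.choose k * (k + 1) ^ k := Nat.mul_le_mul_right _ h1
          _ = _ := by ring
      exact Nat.le_of_mul_le_mul_left this (by positivity)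
    calc (m + 1) ^ (k + 1) = (m + 1) * (m + 1) ^ k := pow_succ' _ _
      _ ≤ (m + 1) * ((k + 1) ^ k * m.choose k) := Nat.mul_le_mul_left _ h3
      _ = (k + 1) ^ k * ((m + 1) * m.choose k) := by ring
      _ = (k + 1) ^ k * ((m + 1).choose (k + 1) * (k + 1)) := by rw [Nat.add_one_mul_choose_eq]
      _ = _ := by ring

lemma four_pow_mul_le_choose {k t : ℕ} (hk : 0 < k) (ht : t ≤ k) :
    (4 : ℝ) ^ k * (3 / 2) ^ t ≤ 2 * k * (2 * k + t).choose k := by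
  induction t with
  | zero =>
    have := Nat.four_pow_le_two_mul_self_mul_centralBinom k hk
    rw [Nat.centralBinom] at this
    simpa using (by exact_mod_cast this : (4 : ℝ) ^ k ≤ 2 * k * (2 * k).choose k)
  | succ t ih =>
    have h1 := ih (by omega)
    have h2 := Nat.choose_mul_succ_eq (2 * k + t) k
    have h3 : 2 * k + t + 1 - k = k + t + 1 := by omega
    rw [h3] at h2
    have h4 : ((2 * k + t).choose k : ℝ) * (2 * k + t + 1) =
        (2 * k + t + 1).choose k * (k + t + 1) := by exact_mod_cast h2
    have h5 : (t + 1 : ℝ) ≤ k := by exact_mod_cast ht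
    have h6 : (3 / 2 : ℝ) * (2 * k + t).choose k ≤ (2 * k + t + 1).choose k := by
      have h7 : (0 : ℝ) < k + t + 1 := by positivity
      rw [← mul_le_mul_iff_left₀ h7, ← h4]
      have : (0 : ℝ) ≤ (2 * k + t).choose k := by positivity
      nlinarith
    calc (4 : ℝ) ^ k * (3 / 2) ^ (t + 1) = 3 / 2 * (4 ^ k * (3 / 2) ^ t) := by ring
      _ ≤ 3 / 2 * (2 * k * (2 * k + t).choose k) := by gcongr
      _ = 2 * k * (3 / 2 * (2 * k + t).choose k) := by ring
      _ ≤ 2 * k * (2 * k + t + 1).choose k := by gcongr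

lemma le_log_choose {k t : ℕ} (hk : 0 < k) (ht : t ≤ k) :
    k * Real.log 4 + t * Real.log (3 / 2) - Real.log (2 * k) ≤
      Real.log ((2 * k + t).choose k) := by
  have h := Real.log_le_log (by positivity) (four_pow_mul_le_choose hk ht)
  have hC : (0 : ℝ) < (2 * k + t).choose k := by
    exact_mod_cast Nat.choose_pos (show k ≤ 2 * k + t by omega)
  rw [Real.log_mul (by positivity) (by positivity), Real.log_mul (by positivity) hC.ne',
    Real.log_pow, Real.log_pow] at h
  linarith

lemma mul_sqrt_le_log {r : ℝ} (h6 : 6 ≤ r) (h840 : r ≤ 840) :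
    0.147 * √r ≤ Real.log (r / 4) := by
  set u := √r with hu
  have hr : r = u ^ 2 := (Real.sq_sqrt (by linarith)).symm
  have hu1 : 2.44 ≤ u := Real.le_sqrt_of_sq_le (by linarith)
  have hu2 : u ≤ 29 := Real.sqrt_le_iff.mpr ⟨by norm_num, by linarith⟩
  obtain ⟨-, hconc⟩ := strictConcaveOn_log_Ioi.concaveOn
  have ha : (0.0735 : ℝ) * 2.44 ≤ Real.log 1.22 := by
    have := Real.one_sub_inv_le_log_of_pos (show (0 : ℝ) < 1.22 by norm_num)
    norm_num at this ⊢
    linarith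
  have hb : (0.0735 : ℝ) * 29 ≤ Real.log 14.5 := by
    have h1 : Real.log (2 ^ 7) ≤ Real.log (14.5 ^ 2) :=
      Real.log_le_log (by norm_num) (by norm_num)
    rw [Real.log_pow, Real.log_pow] at h1
    have := Real.log_two_gt_d9
    norm_num at h1 ⊢
    linarith
  have h := hconc (Set.mem_Ioi.mpr (show (0 : ℝ) < 1.22 by norm_num))
    (Set.mem_Ioi.mpr (show (0 : ℝ) < 14.5 by norm_num))
    (a := (29 - u) / 26.56) (b := (u - 2.44) / 26.56)
    (div_nonneg (by linarith) (by norm_num)) (div_nonneg (by linarith) (by norm_num))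
    (by ring)
  simp only [smul_eq_mul] at h
  have e1 : (29 - u) / 26.56 * 1.22 + (u - 2.44) / 26.56 * 14.5 = u / 2 := by ring
  rw [e1] at h
  have h2 : Real.log (r / 4) = 2 * Real.log (u / 2) := by
    rw [hr, show u ^ 2 / 4 = (u / 2) ^ 2 by ring, Real.log_pow]
    norm_num
  have h3 : (29 - u) / 26.56 * (0.0735 * 2.44) ≤ (29 - u) / 26.56 * Real.log 1.22 :=
    mul_le_mul_of_nonneg_left ha (div_nonneg (by linarith) (by norm_num))
  have h4 : (u - 2.44) / 26.56 * (0.0735 * 29) ≤ (u - 2.44) / 26.56 * Real.log 14.5 :=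
    mul_le_mul_of_nonneg_left hb (div_nonneg (by linarith) (by norm_num))
  rw [h2]
  linarith

lemma cbrt_mul_log_le {x : ℝ} (hx : 0 < x) : x ^ (1 / 3 : ℝ) * Real.log x ≤ 2.208 * √x := by
  set u := x ^ (1 / 6 : ℝ) with hu
  have hupos : 0 < u := Real.rpow_pos_of_pos hx _
  have h1 : x ^ (1 / 3 : ℝ) = u ^ 2 := by
    rw [hu, ← Real.rpow_natCast, ← Real.rpow_mul hx.le]
    norm_num
  have h2 : √x = u ^ 3 := by
    rw [Real.sqrt_eq_rpow, hu, ← Real.rpow_natCast, ← Real.rpow_mul hx.le]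
    norm_num
  have h3 : Real.log u = 1 / 6 * Real.log x := Real.log_rpow hx _
  have h4 := Real.log_le_sub_one_of_pos (div_pos hupos (Real.exp_pos 1))
  rw [Real.log_div hupos.ne' (Real.exp_pos 1).ne', Real.log_exp] at h4
  have h5 : u / Real.exp 1 ≤ 0.368 * u := by
    rw [div_le_iff₀ (Real.exp_pos 1)]
    have := Real.exp_one_gt_d9
    nlinarith
  have h6 : Real.log x ≤ 2.208 * u := by linarith
  rw [h1, h2]
  nlinarith [sq_nonneg u]

lemma log_add_seven_le {k : ℝ} (hk : 1000 ≤ k) : Real.log (k + 7) ≤ 0.063 * √k + 4.932 := by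
  set v := √(k + 7) with hv
  have hvpos : 0 < v := Real.sqrt_pos.mpr (by linarith)
  have h1 : k + 7 = v ^ 2 := (Real.sq_sqrt (by linarith)).symm
  have h2 := Real.log_le_sub_one_of_pos (show 0 < v / 2 ^ 5 by positivity)
  rw [Real.log_div hvpos.ne' (by norm_num), Real.log_pow] at h2
  have h3 := Real.log_two_lt_d9
  have h4 : v ≤ 1.004 * √k := by
    rw [hv]
    refine Real.sqrt_le_iff.mpr ⟨by positivity, ?_⟩
    rw [mul_pow, Real.sq_sqrt (by linarith)]
    linarith
  rw [h1, Real.log_pow]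
  norm_num at h2 ⊢
  linarith

theorem exists_prime_dvd_choose {n k : ℕ} (hk : 1000 ≤ k) (h2 : 2 * k ≤ n) (h840 : n ≤ 840 * k) :
    ∃ p, p.Prime ∧ k + 7 < p ∧ p ∣ n.choose k := by
  by_contra! hcon
  have hpk (p : ℕ) (hp : p.Prime) (hd : p ∣ n.choose k) : p ≤ k + 7 := by
    by_contra! h
    exact hcon p hp h hd
  have hn : 0 < n := by omega
  set c := ⌊(n : ℝ) ^ (1 / 3 : ℝ)⌋₊ with hc
  have hcp (p : ℕ) (hp : p ^ 3 ≤ n) : p ≤ c := by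
    refine Nat.le_floor ?_
    have h1 : ((p : ℝ) ^ 3) ^ (1 / 3 : ℝ) ≤ (n : ℝ) ^ (1 / 3 : ℝ) :=
      Real.rpow_le_rpow (by positivity) (by exact_mod_cast hp) (by norm_num)
    rwa [← Real.rpow_natCast, ← Real.rpow_mul (by positivity), show ((3 : ℕ) : ℝ) * (1 / 3) = 1 by
      norm_num, Real.rpow_one] at h1
  have hC : (0 : ℝ) < n.choose k := by exact_mod_cast Nat.choose_pos (show k ≤ n by omega)
  have upper (y : ℕ) (hy : Nat.sqrt n ≤ y)
      (hp : ∀ p, p.Prime → p ∣ n.choose k → p ≤ y ∨ (k < p ∧ p ≤ k + 7)) :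
      Real.log (n.choose k) ≤ y * Real.log 4 + 7 * Real.log (k + 7) + 3.6 * √n := by
    have h := choose_le_of_prime_factors_le (by omega) hn hy hcp hp
    have h' : (n.choose k : ℝ) ≤ 4 ^ y * (k + 7) ^ 7 * 4 ^ Nat.sqrt n * n ^ c := by
      have h1 := h.trans (Nat.mul_le_mul_right (n ^ c) (Nat.mul_le_mul
        (Nat.mul_le_mul_right ((k + 7) ^ 7) (primorial_le_four_pow y))
        (primorial_le_four_pow (Nat.sqrt n))))
      exact_mod_cast h1
    have h3 := Real.log_le_log hC h'
    have hn' : (0 : ℝ) < n := by exact_mod_cast hn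
    rw [Real.log_mul (by positivity) (by positivity), Real.log_mul (by positivity) (by positivity),
      Real.log_mul (by positivity) (by positivity), Real.log_pow, Real.log_pow, Real.log_pow,
      Real.log_pow] at h3
    have h4 : (Nat.sqrt n : ℝ) ≤ √n := Real.nat_sqrt_le_real_sqrt
    have h5 : (c : ℝ) ≤ (n : ℝ) ^ (1 / 3 : ℝ) := Nat.floor_le (by positivity)
    have h6 := cbrt_mul_log_le hn'
    have h7 : (c : ℝ) * Real.log n ≤ (n : ℝ) ^ (1 / 3 : ℝ) * Real.log n :=
      mul_le_mul_of_nonneg_right h5 (Real.log_natCast_nonneg n)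
    have h8 : Real.log 4 ≤ 1.3863 := by
      rw [show (4 : ℝ) = 2 ^ 2 by norm_num, Real.log_pow]
      have := Real.log_two_lt_d9
      norm_num
      linarith
    have h9 : (Nat.sqrt n : ℝ) * Real.log 4 ≤ √n * 1.3863 :=
      mul_le_mul h4 h8 (Real.log_nonneg (by norm_num)) (by positivity)
    have h10 : (0 : ℝ) ≤ √n := by positivity
    push_cast at h3
    linarith
  have hsqrt : Nat.sqrt n ≤ k := by
    by_contra! h
    have := Nat.le_sqrt'.mp (Nat.succ_le_of_lt h)
    nlinarith
  have hkR : (1000 : ℝ) ≤ k := by exact_mod_cast hk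
  have hκ : (31.6 : ℝ) ≤ √k := Real.le_sqrt_of_sq_le (by norm_num; linarith)
  have hκ2 : √(k : ℝ) ^ 2 = k := Real.sq_sqrt (by linarith)
  have hlog := log_add_seven_le hkR
  have hlog2k : Real.log (2 * k) ≤ 0.7 + Real.log (k + 7) := by
    rw [Real.log_mul (by norm_num) (by linarith)]
    have := Real.log_two_lt_d9
    have := Real.log_le_log (by linarith) (show (k : ℝ) ≤ k + 7 by linarith)
    linarith
  have hlog32 : 0.4 ≤ Real.log (3 / 2) := by
    have h1 : Real.log (2 * 1.125) = Real.log ((3 / 2) ^ 2) := by norm_num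
    rw [Real.log_mul (by norm_num) (by norm_num), Real.log_pow] at h1
    have h2 := Real.log_two_gt_d9
    have h3 := Real.one_sub_inv_le_log_of_pos (show (0 : ℝ) < 1.125 by norm_num)
    norm_num at h1 h3 ⊢
    linarith
  have hmain : 0.4 * (k : ℝ) ≤ k * Real.log (3 / 2) := by nlinarith
  have hsq {b : ℝ} (hb : 0 ≤ b) (h : (n : ℝ) ≤ b ^ 2 * k) : √(n : ℝ) ≤ b * √k := by
    refine Real.sqrt_le_iff.mpr ⟨by positivity, ?_⟩
    rwa [mul_pow, hκ2]
  rcases le_total n (3 * k) with h3 | h3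
  · obtain ⟨t, rfl⟩ := Nat.exists_eq_add_of_le h2
    have hlow := le_log_choose (t := t) (by omega) (by omega : t ≤ k)
    have hup := upper ((2 * k + t) / 3) (by
      have h4 := Nat.sqrt_le' (2 * k + t)
      have h5 : 3 ≤ Nat.sqrt (2 * k + t) := Nat.le_sqrt'.mpr (by omega)
      rw [Nat.le_div_iff_mul_le (by norm_num)]
      nlinarith) (by
      intro p hp hd
      by_contra! hcon
      have hle := hpk p hp hd
      have hpk' : p ≤ k := by
        by_contra! h
        exact absurd (hcon.2 h) (by omega)
      have := Nat.factorization_choose_of_lt_three_mul (p := p) (n := 2 * k + t) (k := k)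
        (by omega) hpk' (by omega) (by omega)
      exact (hp.factorization_pos_of_dvd (by exact_mod_cast hC.ne') hd).ne' this)
    have h4 : (((2 * k + t) / 3 : ℕ) : ℝ) ≤ (2 * k + t) / 3 := by
      have := @Nat.cast_div_le ℝ _ _ _ (2 * k + t) 3
      push_cast at this
      exact this
    have h5 := hsq (b := 1.74) (by norm_num) (by
      have : ((2 * k + t : ℕ) : ℝ) ≤ 3 * k := by exact_mod_cast h3
      norm_num at this ⊢
      linarith)
    have h6 : 3 * Real.log (3 / 2) ≤ Real.log 4 := by
      have := Real.log_le_log (by norm_num) (show ((3 : ℝ) / 2) ^ 3 ≤ 4 by norm_num)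
      rwa [Real.log_pow] at this
    have h7 : (t : ℝ) ≤ k := by exact_mod_cast (by omega : t ≤ k)
    have h8 : (((2 * k + t) / 3 : ℕ) : ℝ) * Real.log 4 ≤ (2 * k + t) / 3 * Real.log 4 :=
      mul_le_mul_of_nonneg_right h4 (Real.log_nonneg (by norm_num))
    have h9 : (k - t) * (3 * Real.log (3 / 2)) ≤ (k - t) * Real.log 4 :=
      mul_le_mul_of_nonneg_left h6 (by linarith)
    nlinarith
  have hup := upper k hsqrt fun p hp hd => by
    have := hpk p hp hd
    omega
  rcases le_total n (6 * k) with h6 | h6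
  · have hlow := le_log_choose (t := k) (by omega) le_rfl
    have hmono : ((2 * k + k).choose k : ℝ) ≤ n.choose k := by
      exact_mod_cast Nat.choose_le_choose k (by omega)
    have hlow2 := Real.log_le_log (by exact_mod_cast Nat.choose_pos (by omega)) hmono
    have h5 := hsq (b := 2.45) (by norm_num) (by
      have : (n : ℝ) ≤ 6 * k := by exact_mod_cast h6
      norm_num
      linarith)
    nlinarith
  · have hn6 : (6 * k : ℝ) ≤ n := by exact_mod_cast h6
    have hn840 : (n : ℝ) ≤ 840 * k := by exact_mod_cast h840
    have hkpos : (0 : ℝ) < k := by linarith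
    have h7 : ((n : ℝ) / k) ^ k ≤ n.choose k := by
      rw [div_pow, div_le_iff₀ (by positivity), mul_comm]
      exact_mod_cast pow_le_pow_mul_choose (show k ≤ n by omega)
    have h8 := Real.log_le_log (pow_pos (div_pos (by linarith) hkpos) _) h7
    rw [Real.log_pow] at h8
    have h9 := mul_sqrt_le_log (r := n / k) ((le_div_iff₀ hkpos).mpr hn6)
      ((div_le_iff₀ hkpos).mpr hn840)
    rw [Real.log_div (by positivity) (by norm_num), Real.sqrt_div (by positivity)] at h9
    have h10 : (k : ℝ) * (0.147 * (√n / √k)) = 0.147 * √n * √k := by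
      have : (0 : ℝ) < √k := by linarith
      field_simp
      linarith
    have h11 := mul_le_mul_of_nonneg_left h9 hkpos.le
    rw [h10] at h11
    have h12 : 2.44 * √k ≤ √(n : ℝ) := by
      refine Real.le_sqrt_of_sq_le ?_
      rw [mul_pow, hκ2]
      norm_num
      linarith
    nlinarith

theorem exists_prime_dvd_sub {n k : ℕ} (hk : 1000 ≤ k) (h2 : 2 * k ≤ n) (h840 : n ≤ 840 * k) :
    ∃ p i, p.Prime ∧ k + 7 < p ∧ i < k ∧ p ∣ n - i := by
  obtain ⟨p, hp, hkp, hd⟩ := exists_prime_dvd_choose hk h2 h840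
  have h1 : p ∣ n.descFactorial k := by
    rw [Nat.descFactorial_eq_factorial_mul_choose]
    exact hd.mul_left _
  rw [Nat.descFactorial_eq_prod_range, hp.prime.dvd_finsetProd_iff] at h1
  obtain ⟨i, hi, hpi⟩ := h1
  exact ⟨p, i, hp, hkp, Finset.mem_range.mp hi, hpi⟩

end LargePrimes

section SmallDegree

/-- The triples `(s, n, d)` for which irreducible factors of degree `d` of `g1 n s` have to be
excluded separately. -/
def exceptionalTriples : List (ℕ × ℕ × ℕ) :=
  [(2, 2, 1), (3, 2, 1), (3, 6, 1), (4, 4, 1), (4, 6, 1), (5, 4, 1), (5, 6, 1), (5, 20, 1),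
    (6, 2, 1), (6, 3, 1), (6, 4, 1), (6, 6, 1), (6, 12, 1), (6, 20, 1), (7, 2, 1), (7, 3, 1),
    (7, 4, 1), (7, 6, 1), (7, 12, 1), (7, 20, 1), (7, 42, 1), (8, 3, 1), (8, 8, 1), (8, 12, 1),
    (8, 24, 1), (8, 42, 1), (8, 120, 1), (4, 6, 2), (4, 6, 3), (5, 4, 2), (6, 4, 2), (6, 10, 5),
    (7, 4, 2)]

/-- The least common multiple of `1, …, B`. -/
def lcmUpTo : ℕ → ℕ
  | 0 => 1
  | B + 1 => Nat.lcm (B + 1) (lcmUpTo B)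

/-- A test for `m` having a prime factor exceeding `B`, valid for `m < 2 ^ 20`. -/
def isRough (m B : ℕ) : Bool := !Nat.beq (Nat.mod (Nat.pow (lcmUpTo B) 20) m) 0

/-- An upper bound for `d + 7` (for `d < 1000`) taking few values. -/
def smoothBound (d : ℕ) : ℕ :=
  bif Nat.ble d 1 then 8 else bif Nat.ble d 5 then 12 else bif Nat.ble d 9 then 16 else
  bif Nat.ble d 17 then 24 else bif Nat.ble d 25 then 32 else bif Nat.ble d 41 then 48 else
  bif Nat.ble d 57 then 64 else bif Nat.ble d 89 then 96 else bif Nat.ble d 121 then 128 else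
  bif Nat.ble d 185 then 192 else bif Nat.ble d 249 then 256 else bif Nat.ble d 393 then 400 else
  bif Nat.ble d 693 then 700 else 1007

/-- A test for the primes up to `61` excluding a factor of degree `d`. -/
def isExcluded (s n d : ℕ) : Bool :=
  [2, 3, 5, 7, 11, 13, 17, 19, 23, 29, 31, 37, 41, 43, 47, 53, 59, 61].any fun p =>
    (n + s).descFactorial s / s.factorial % p != 0 &&
      ((List.range 5).any (fun m => n % p ^ m == 0 && d % p ^ m != 0) ||
        Nat.blt d p && (List.range d).any fun i => (n - i) % p == 0)

def checkPair (n d : ℕ) : Bool :=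
  (List.range (min d 40)).any (fun i => isRough (n - i) (smoothBound d)) ||
    (List.range 9).all fun s => exceptionalTriples.contains (s, n, d) || isExcluded s n d

def divisors840 : List ℕ :=
  [1, 2, 3, 4, 5, 6, 7, 8, 10, 12, 14, 15, 20, 21, 24, 28, 30, 35, 40, 42, 56, 60, 70, 84, 105, 120,
    140, 168, 210, 280, 420, 840]

def checkGcd (g m : ℕ) : Bool :=
  Nat.blt 1007 (g * m) && (List.range (min g 20)).any (fun i => isRough (g * m - i) 1007) ||
    (List.range (m / 2 + 1)).all fun c =>
      Nat.beq c 0 || Nat.ble 1000 (g * c) || !Nat.beq (Nat.gcd c m) 1 || checkPair (g * m) (g * c)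

set_option maxRecDepth 100000 in
lemma checkGcd_of_lt : (List.range 1000).all (fun g => Nat.beq g 0 ||
    divisors840.all (checkGcd g)) = true := by
  decide +kernel

lemma dvd_lcmUpTo {a B : ℕ} (ha : 0 < a) (h : a ≤ B) : a ∣ lcmUpTo B := by
  induction B with
  | zero => omega
  | succ B ih =>
    rcases h.lt_or_eq with h | rfl
    · exact (ih (by omega)).trans (Nat.dvd_lcm_right _ _)
    · exact Nat.dvd_lcm_left _ _

lemma exists_prime_of_isRough {m B : ℕ} (hm : m < 2 ^ 20) (h : isRough m B = true) :
    ∃ p, p.Prime ∧ B < p ∧ p ∣ m := by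
  by_contra! hcon
  have hdvd : m ∣ lcmUpTo B ^ 20 := by
    rw [Nat.dvd_iff_prime_pow_dvd_dvd]
    intro p k hp hk
    rcases Nat.eq_zero_or_pos m with rfl | hm0
    · have h1 := Nat.exists_infinite_primes (B + 1)
      obtain ⟨q, hq, hqp⟩ := h1
      exact absurd (dvd_zero q) (hcon q hqp (by omega))
    rcases Nat.eq_zero_or_pos k with rfl | hk0
    · simp
    have hpB : p ≤ B := by
      by_contra! hlt
      exact hcon p hp hlt ((dvd_pow_self p hk0.ne').trans hk)
    have hk20 : k < 20 := (Nat.pow_lt_pow_iff_right (a := 2) (by norm_num)).mp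
      (((Nat.pow_le_pow_left hp.two_le k).trans (Nat.le_of_dvd hm0 hk)).trans_lt hm)
    exact (pow_dvd_pow_of_dvd (dvd_lcmUpTo hp.pos hpB) k).trans (pow_dvd_pow _ hk20.le)
  have h0 : lcmUpTo B ^ 20 % m = 0 := Nat.mod_eq_zero_of_dvd hdvd
  rw [isRough, Nat.pow_eq, show Nat.mod (lcmUpTo B ^ 20) m = 0 from h0] at h
  simp at h

lemma le_smoothBound {d : ℕ} (hd : d < 1000) : d + 7 ≤ smoothBound d := by
  have h : ∀ d < 1000, Nat.ble (d + 7) (smoothBound d) = true := by decide +kernel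
  exact Nat.le_of_ble_eq_true (h d hd)

lemma mem_divisors840 {m : ℕ} (h : m ∣ 840) : m ∈ divisors840 := by
  have h1 : ∀ m < 841, 840 % m = 0 → m ∈ divisors840 := by decide +kernel
  exact h1 m (Nat.lt_succ_of_le (Nat.le_of_dvd (by norm_num) h)) (Nat.mod_eq_zero_of_dvd h)

lemma not_dvd_add_choose {p n s L r : ℕ} (hp : p.Prime) (hr : n % p ^ L = r) (h : r + s < p ^ L)
    (hC : ¬ p ∣ (r + s).choose s) : ¬ p ∣ (n + s).choose s := by
  have := Fact.mk hp
  have h0 := padicValNat_add_choose hp n s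
  have h1 := padicValNat_add_choose hp r s
  have hn : n = p ^ L * (n / p ^ L) + r := by rw [← hr, Nat.div_add_mod]
  have h2 := sum_digits_pow_mul_add hp.one_lt L (n / p ^ L) (show r < p ^ L by omega)
  have h3 := sum_digits_pow_mul_add hp.one_lt L (n / p ^ L) h
  rw [← hn] at h2
  rw [← add_assoc, ← hn] at h3
  rw [padicValNat.eq_zero_of_not_dvd hC] at h1
  have h4 : (p - 1 : ℤ) * padicValNat p ((n + s).choose s) = 0 := by
    rw [h0, h2, h3]
    push_cast at h1 ⊢
    linarith
  have hp1 : (p : ℤ) - 1 ≠ 0 := by have := hp.one_lt; omega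
  have h5 := (mul_eq_zero.mp h4).resolve_left hp1
  intro hd
  have := one_le_padicValNat_of_dvd (Nat.choose_pos (by omega)).ne' hd
  omega

/-- A sufficient condition for `g1 n s` to have no irreducible factor of degree `d`. -/
def HasWitness (n s d : ℕ) : Prop :=
  (∃ p m, p.Prime ∧ ¬ p ∣ (n + s).choose s ∧ p ^ m ∣ n ∧ ¬ p ^ m ∣ d) ∨
    ∃ p i, p.Prime ∧ ¬ p ∣ (n + s).choose s ∧ d < p ∧ i < d ∧ p ∣ n - i

lemma hasWitness_of_isExcluded {n s d : ℕ} (h : isExcluded s n d = true) : HasWitness n s d := by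
  simp only [isExcluded, List.any_eq_true, Bool.and_eq_true, Bool.or_eq_true, List.mem_range,
    beq_iff_eq, bne_iff_ne, ← Nat.choose_eq_descFactorial_div_factorial] at h
  obtain ⟨p, hp, hC, h⟩ := h
  have hpp : p.Prime := by
    have : ∀ p ∈ [2, 3, 5, 7, 11, 13, 17, 19, 23, 29, 31, 37, 41, 43, 47, 53, 59, 61],
        p.Prime := by norm_num
    exact this p hp
  replace hC : ¬ p ∣ (n + s).choose s := fun hd => hC (Nat.mod_eq_zero_of_dvd hd)
  rcases h with ⟨m, -, h1, h2⟩ | ⟨h1, i, hi, h2⟩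
  · exact Or.inl ⟨p, m, hpp, hC, Nat.dvd_of_mod_eq_zero h1,
      fun hd => h2 (Nat.mod_eq_zero_of_dvd hd)⟩
  · exact Or.inr ⟨p, i, hpp, hC, by simpa [Nat.blt_eq] using h1, hi, Nat.dvd_of_mod_eq_zero h2⟩

lemma hasWitness_of_large_prime {n s d p i : ℕ} (hs : s ≤ 8) (hdn : d ≤ n) (hp : p.Prime)
    (hdp : d + 7 < p) (hi : i < d) (hpi : p ∣ n - i) : HasWitness n s d := by
  have h1 : n % p ^ 1 = i := by
    obtain ⟨q, hq⟩ := hpi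
    rw [pow_one, show n = p * q + i by omega, Nat.mul_add_mod, Nat.mod_eq_of_lt (by omega)]
  have h2 : ¬ p ∣ (i + s).choose s := fun h => by
    have := hp.dvd_factorial.mp (h.trans
      ⟨_, (Nat.add_choose_mul_factorial_mul_factorial i s).symm.trans (mul_assoc _ _ _)⟩)
    omega
  exact Or.inr ⟨p, i, hp, not_dvd_add_choose hp h1 (by rw [pow_one]; omega) h2, by omega, hi, hpi⟩

lemma dvd_gcd_mul {n s d : ℕ} (hs : s ≤ 8) (h : ¬ HasWitness n s d) : n ∣ n.gcd d * 840 := by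
  rw [Nat.dvd_iff_prime_pow_dvd_dvd]
  intro p m hp hm
  by_cases hC : p ∣ (n + s).choose s
  · have hle : p ^ m ≤ s := by
      by_contra! hlt
      refine not_dvd_add_choose hp (Nat.mod_eq_zero_of_dvd hm) (by omega) ?_ hC
      simpa using hp.ne_one
    have h840 : ∀ a ≤ 8, 0 < a → a ∣ 840 := by decide
    exact (h840 _ (hle.trans hs) (pow_pos hp.pos m)).mul_left _
  · have hd : p ^ m ∣ d := by
      by_contra hd
      exact h (Or.inl ⟨p, m, hp, hC, hm, hd⟩)
    exact (Nat.dvd_gcd hm hd).mul_right _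

theorem hasWitness_or_exceptional {n s d : ℕ} (hs : s ≤ 8) (hd : 1 ≤ d) (hdn : 2 * d ≤ n) :
    HasWitness n s d ∨ (s, n, d) ∈ exceptionalTriples := by
  by_contra! hcon
  obtain ⟨hW, hE⟩ := hcon
  have h840 := dvd_gcd_mul hs hW
  set g := n.gcd d with hg
  have hg0 : 0 < g := Nat.gcd_pos_of_pos_right _ hd
  have hgd : g ≤ d := Nat.gcd_le_right _ hd
  obtain ⟨m, c, hmc, hnm, hdc⟩ := Nat.exists_coprime n d
  rw [← hg] at hnm hdc
  have hm840 : m ∣ 840 := by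
    rw [hnm, mul_comm] at h840
    exact Nat.dvd_of_mul_dvd_mul_left hg0 h840
  have hmle := Nat.le_of_dvd (by norm_num) hm840
  have hn840 : n ≤ 840 * d := by
    rw [hnm]
    exact Nat.mul_le_mul hmle hgd
  have hlarge {p i : ℕ} (hp : p.Prime) (hdp : d + 7 < p) (hi : i < d) (hpi : p ∣ n - i) : False :=
    hW (hasWitness_of_large_prime hs (by omega) hp hdp hi hpi)
  rcases le_or_gt 1000 d with h1000 | h1000
  · obtain ⟨p, i, hp, hdp, hi, hpi⟩ := exists_prime_dvd_sub h1000 hdn hn840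
    exact hlarge hp hdp hi hpi
  have hn20 : n < 2 ^ 20 := by omega
  have hcheck := checkGcd_of_lt
  rw [List.all_eq_true] at hcheck
  have h1 := hcheck g (List.mem_range.mpr (by omega))
  rw [Bool.or_eq_true, Nat.beq_eq, List.all_eq_true] at h1
  have h2 := (h1.resolve_left hg0.ne') m (mem_divisors840 hm840)
  have hgm : g * m = n := by rw [hnm, mul_comm]
  have hgc : g * c = d := by rw [hdc, mul_comm]
  simp only [checkGcd, hgm, Bool.or_eq_true, Bool.and_eq_true, List.any_eq_true, List.all_eq_true,
    List.mem_range, lt_min_iff] at h2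
  rcases h2 with ⟨-, i, hi, hr⟩ | h2
  · obtain ⟨p, hp, hBp, hpi⟩ := exists_prime_of_isRough (by omega) hr
    exact hlarge hp (by omega) (by omega) hpi
  have hcm : c < m / 2 + 1 := by
    have : 2 * c ≤ m := by
      refine Nat.le_of_mul_le_mul_left ?_ hg0
      rw [hgm]
      linarith
    omega
  have h3 := h2 c hcm
  rw [hgc] at h3
  rcases h3 with ((h3 | h3) | h3) | h3
  · rw [Nat.beq_eq] at h3
    rw [h3] at hgc
    omega
  · have := Nat.le_of_ble_eq_true h3
    omega
  · simp [Nat.coprime_comm.mp hmc] at h3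
  · simp only [checkPair, Bool.or_eq_true, List.any_eq_true, List.all_eq_true, List.mem_range,
      lt_min_iff, List.contains_iff_mem] at h3
    rcases h3 with ⟨i, hi, hr⟩ | h3
    · obtain ⟨p, hp, hBp, hpi⟩ := exists_prime_of_isRough (by omega) hr
      have := le_smoothBound h1000
      exact hlarge hp (by omega) hi.1 hpi
    · rcases h3 s (by omega) with h | h
      · exact hE h
      · exact hW (hasWitness_of_isExcluded h)

end SmallDegree

section ExceptionalTriples

variable {f : ℤ[X]}

lemma natDegree_ne_one_of_forall_mod_ne_zero (hf : f.Monic) {n s : ℕ} (hfG : f ∣ intG1 n s) (q : ℕ)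
    (hq : 0 < q)
    (h : ∀ r < q, (∑ j ∈ Finset.range (n + 1), g1Coeff n s j * r ^ j) % q ≠ 0) :
    f.natDegree ≠ 1 := by
  intro hd
  have : NeZero q := ⟨hq.ne'⟩
  have hroot : f.eval (-f.coeff 0) = 0 := by
    rw [hf.eq_X_add_C hd]
    simp
  have h0 : (intG1 n s).eval (-f.coeff 0) = 0 := by
    obtain ⟨g, hg⟩ := hfG
    rw [hg, eval_mul, hroot, zero_mul]
  have h1 : ((∑ j ∈ Finset.range (n + 1), g1Coeff n s j * ((-f.coeff 0 : ℤ) : ZMod q).val ^ j : ℕ) :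
      ZMod q) = 0 := by
    have h2 := congrArg (Int.cast : ℤ → ZMod q) h0
    simp only [intG1, eval_finsetSum, eval_mul, eval_C, eval_pow, eval_X, Int.cast_sum,
      Int.cast_mul, Int.cast_pow, Int.cast_natCast, Int.cast_zero] at h2
    simp only [Nat.cast_sum, Nat.cast_mul, Nat.cast_pow, ZMod.natCast_val, ZMod.cast_id]
    exact h2
  exact h _ (ZMod.val_lt _) (Nat.mod_eq_zero_of_dvd ((ZMod.natCast_eq_zero_iff _ _).mp h1))

lemma exists_le_of_newtonSlope_intG1 {p : ℕ} (hp : p.Prime) {n s e x : ℕ}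
    (hN : IsNewtonSlope (intG1 n s) p e x) (v : ℕ → ℕ)
    (hv : ∀ j < n + 1, g1Coeff n s j % p ^ v j = 0 ∧ g1Coeff n s j % p ^ (v j + 1) ≠ 0)
    (j : ℕ) (hj : j < n + 1) : ∃ i < n + 1, i ≠ j ∧ e * v i + i * x ≤ e * v j + j * x := by
  have := Fact.mk hp
  have hval {j : ℕ} (hj : j ≤ n) : padicValInt p ((intG1 n s).coeff j) = v j := by
    obtain ⟨h1, h2⟩ := hv j (by omega)
    rw [coeff_intG1, if_pos hj, padicValInt.of_nat]
    have h0 := (g1Coeff_pos n s j).ne'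
    refine le_antisymm ?_ ((padicValNat_dvd_iff_le h0).mp (Nat.dvd_of_mod_eq_zero h1))
    by_contra! hlt
    exact h2 (Nat.mod_eq_zero_of_dvd ((padicValNat_dvd_iff_le h0).mpr hlt))
  obtain ⟨i, hij, hi, hle⟩ := hN j (coeff_intG1_ne_zero.mpr (by omega))
  rw [coeff_intG1_ne_zero] at hi
  rw [hval hi, hval (by omega)] at hle
  exact ⟨i, by omega, hij, hle⟩

lemma natDegree_ne_of_not_sq_dvd (hf : f.Monic) (hirr : Irreducible f) {n s : ℕ}
    (hfG : f ∣ intG1 n s) (p : ℕ) (hp : p.Prime) {d : ℕ} (hd : 2 * d ≤ n)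
    (h : ∀ j < n - d + 1, g1Coeff n s j % p = 0) (h0 : g1Coeff n s 0 % p ^ 2 ≠ 0) :
    f.natDegree ≠ d := by
  rintro rfl
  have := Fact.mk hp
  have hf0 := dvd_coeff_zero_of_dvd_g1Coeff hf hfG hp
    fun j hj => Nat.dvd_of_mod_eq_zero (h j (by omega))
  obtain ⟨e, x, he, hed, hx, hN⟩ := exists_newtonSlope_of_dvd_coeff_zero hf hirr hfG
    (coeff_intG1_ne_zero.mpr (Nat.zero_le _)) hp hf0
  obtain ⟨i, hi0, hi, hle⟩ := hN 0 (coeff_intG1_ne_zero.mpr (Nat.zero_le _))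
  rw [coeff_intG1_ne_zero] at hi
  rw [coeff_intG1, if_pos hi, coeff_intG1, if_pos (Nat.zero_le _), padicValInt.of_nat,
    padicValInt.of_nat] at hle
  have hv0 : padicValNat p (g1Coeff n s 0) ≤ 1 := by
    by_contra! hlt
    exact h0 (Nat.mod_eq_zero_of_dvd ((padicValNat_dvd_iff_le (g1Coeff_pos n s 0).ne').mpr hlt))
  have h1 : e * padicValNat p (g1Coeff n s 0) ≤ e := by nlinarith
  have hix : i ≤ i * x := Nat.le_mul_of_pos_right _ hx
  by_cases hid : i < n - f.natDegree + 1
  · have hvi := one_le_padicValNat_of_dvd (g1Coeff_pos n s i).ne'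
      (Nat.dvd_of_mod_eq_zero (h i hid))
    have : e ≤ e * padicValNat p (g1Coeff n s i) := Nat.le_mul_of_pos_right _ hvi
    omega
  · have : 0 ≤ e * padicValNat p (g1Coeff n s i) := Nat.zero_le _
    omega

lemma natDegree_ne_two_of_intG1_six_four (hf : f.Monic) (hirr : Irreducible f)
    (hfG : f ∣ intG1 6 4) : f.natDegree ≠ 2 := by
  intro hd
  suffices h : 3 ∣ f.natDegree by omega
  refine dvd_natDegree_of_newtonSlope hf hirr hfG (coeff_intG1_ne_zero.mpr (Nat.zero_le _))
    Nat.prime_three _ fun e x he hed hN => ?_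
  have hslope := exists_le_of_newtonSlope_intG1 Nat.prime_three hN
    (fun j => [3, 4, 2, 1, 2, 1, 0].getD j 0) (by decide +kernel)
  have hx : x ≤ 6 := by
    obtain ⟨i, -, hi, h0⟩ := hslope 0 (by norm_num)
    have : x ≤ i * x := Nat.le_mul_of_pos_left _ (Nat.pos_of_ne_zero hi)
    simp only [List.getD_cons_zero] at h0
    omega
  have key : ∀ e ∈ Finset.Icc 1 2, ∀ x ∈ Finset.range 7,
      ∃ j ∈ Finset.range 7, ∀ i ∈ Finset.range 7, i ≠ j →
      e * [3, 4, 2, 1, 2, 1, 0].getD j 0 + j * x < e * [3, 4, 2, 1, 2, 1, 0].getD i 0 + i * x := by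
    decide +kernel
  obtain ⟨j, hj, hlt⟩ := key e (Finset.mem_Icc.mpr ⟨he, by omega⟩) x
    (Finset.mem_range.mpr (by omega))
  obtain ⟨i, hi, hij, hle⟩ := hslope j (Finset.mem_range.mp hj)
  exact ((hlt i (Finset.mem_range.mpr hi) hij).not_ge hle).elim

lemma natDegree_ne_two_of_intG1_four_seven (hf : f.Monic) (hirr : Irreducible f)
    (hfG : f ∣ intG1 4 7) : f.natDegree ≠ 2 := by
  intro hd
  have h0 : ((3 : ℕ) : ℤ) ∣ f.coeff 0 := by
    refine dvd_coeff_zero_of_dvd_g1Coeff hf hfG Nat.prime_three fun j hj => ?_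
    have h : ∀ j < 3, g1Coeff 4 7 j % 3 = 0 := by decide +kernel
    exact Nat.dvd_of_mod_eq_zero (h j (by omega))
  obtain ⟨e, x, he, hed, hx, hN⟩ := exists_newtonSlope_of_dvd_coeff_zero hf hirr hfG
    (coeff_intG1_ne_zero.mpr (Nat.zero_le _)) Nat.prime_three h0
  have hslope := exists_le_of_newtonSlope_intG1 Nat.prime_three hN
    (fun j => [2, 2, 3, 0, 0].getD j 0) (by decide +kernel)
  have hx6 : x ≤ 6 := by
    obtain ⟨i, -, hi, h0⟩ := hslope 0 (by norm_num)
    have : x ≤ i * x := Nat.le_mul_of_pos_left _ (Nat.pos_of_ne_zero hi)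
    simp only [List.getD_cons_zero] at h0
    omega
  have key : ∀ e ∈ Finset.Icc 1 2, ∀ x ∈ Finset.Icc 1 6,
      ∃ j ∈ Finset.range 5, ∀ i ∈ Finset.range 5, i ≠ j →
      e * [2, 2, 3, 0, 0].getD j 0 + j * x < e * [2, 2, 3, 0, 0].getD i 0 + i * x := by
    decide +kernel
  obtain ⟨j, hj, hlt⟩ := key e (Finset.mem_Icc.mpr ⟨he, by omega⟩) x (Finset.mem_Icc.mpr ⟨hx, hx6⟩)
  obtain ⟨i, hi, hij, hle⟩ := hslope j (Finset.mem_range.mp hj)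
  exact (hlt i (Finset.mem_range.mpr hi) hij).not_ge hle

theorem notMem_exceptionalTriples (hf : f.Monic) (hirr : Irreducible f) {n s : ℕ}
    (hfG : f ∣ intG1 n s) : (s, n, f.natDegree) ∉ exceptionalTriples := by
  intro h
  simp only [exceptionalTriples, List.mem_cons, Prod.mk.injEq, List.not_mem_nil, or_false] at h
  have h1 := natDegree_ne_one_of_forall_mod_ne_zero hf hfG
  rcases h with h | h | h | h | h | h | h | h | h | h | h | h | h | h | h | h | h | h | h | h |
    h | h | h | h | h | h | h | h | h | h | h | h | h <;> obtain ⟨rfl, rfl, hd⟩ := h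
  · exact h1 5 (by norm_num) (by decide +kernel) hd
  · exact h1 3 (by norm_num) (by decide +kernel) hd
  · exact h1 13 (by norm_num) (by decide +kernel) hd
  · exact h1 17 (by norm_num) (by decide +kernel) hd
  · exact h1 11 (by norm_num) (by decide +kernel) hd
  · exact h1 31 (by norm_num) (by decide +kernel) hd
  · exact h1 17 (by norm_num) (by decide +kernel) hd
  · exact h1 47 (by norm_num) (by decide +kernel) hd
  · exact h1 3 (by norm_num) (by decide +kernel) hd
  · exact h1 5 (by norm_num) (by decide +kernel) hd
  · exact h1 13 (by norm_num) (by decide +kernel) hd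
  · exact h1 19 (by norm_num) (by decide +kernel) hd
  · exact h1 23 (by norm_num) (by decide +kernel) hd
  · exact h1 41 (by norm_num) (by decide +kernel) hd
  · exact h1 5 (by norm_num) (by decide +kernel) hd
  · exact h1 7 (by norm_num) (by decide +kernel) hd
  · exact h1 13 (by norm_num) (by decide +kernel) hd
  · exact h1 37 (by norm_num) (by decide +kernel) hd
  · exact h1 43 (by norm_num) (by decide +kernel) hd
  · exact h1 37 (by norm_num) (by decide +kernel) hd
  · exact h1 73 (by norm_num) (by decide +kernel) hd
  · exact h1 13 (by norm_num) (by decide +kernel) hd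
  · exact h1 17 (by norm_num) (by decide +kernel) hd
  · exact h1 37 (by norm_num) (by decide +kernel) hd
  · exact h1 37 (by norm_num) (by decide +kernel) hd
  · exact h1 67 (by norm_num) (by decide +kernel) hd
  · exact h1 139 (by norm_num) (by decide +kernel) hd
  · exact natDegree_ne_two_of_intG1_six_four hf hirr hfG hd
  · exact natDegree_ne_of_not_sq_dvd hf hirr hfG 7 (by norm_num) (by norm_num)
      (by decide +kernel) (by decide +kernel) hd
  · exact natDegree_ne_of_not_sq_dvd hf hirr hfG 7 (by norm_num) (by norm_num)
      (by decide +kernel) (by decide +kernel) hd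
  · exact natDegree_ne_of_not_sq_dvd hf hirr hfG 7 (by norm_num) (by norm_num)
      (by decide +kernel) (by decide +kernel) hd
  · exact natDegree_ne_of_not_sq_dvd hf hirr hfG 11 (by norm_num) (by norm_num)
      (by decide +kernel) (by decide +kernel) hd
  · exact natDegree_ne_two_of_intG1_four_seven hf hirr hfG hd

end ExceptionalTriples

theorem irreducible_intG1 {n s : ℕ} (hn : 1 ≤ n) (hs : s ≤ 8) : Irreducible (intG1 n s) := by
  have hmon := monic_intG1 n s
  have hne : intG1 n s ≠ 1 := fun h => by
    have := natDegree_intG1 n s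
    rw [h, natDegree_one] at this
    omega
  by_contra hcon
  have hex : ∃ d, ∃ q : ℤ[X], q.Monic ∧ 0 < q.natDegree ∧ 2 * q.natDegree ≤ n ∧ q ∣ intG1 n s ∧
      q.natDegree = d := by
    rw [hmon.irreducible_iff_lt_natDegree_lt hne, natDegree_intG1] at hcon
    push Not at hcon
    obtain ⟨q, hq, hd, hdvd⟩ := hcon
    rw [Finset.mem_Ioc] at hd
    exact ⟨_, q, hq, hd.1, by omega, hdvd, rfl⟩
  classical
  obtain ⟨f, hf, hf0, hfn, hfG, hfd⟩ := Nat.find_spec hex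
  have hirr : Irreducible f := by
    rw [hf.irreducible_iff_lt_natDegree_lt (fun h => by simp [h] at hf0)]
    intro q hq hd hdvd
    rw [Finset.mem_Ioc] at hd
    exact Nat.find_min hex (m := q.natDegree) (by omega)
      ⟨q, hq, hd.1, by omega, hdvd.trans hfG, rfl⟩
  rcases hasWitness_or_exceptional hs hf0 hfn with
    (⟨p, m, hp, hC, hm, hd⟩ | ⟨p, i, hp, hC, hd, hi, hpi⟩) | h
  · exact hd (pow_dvd_natDegree hf hirr hfG hp hC hm)
  · exact not_dvd_of_prime_dvd_sub hf hirr hfG hp hC hd hi hpi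
  · exact notMem_exceptionalTriples hf hirr hfG h

lemma map_intG1 (n s : ℕ) : (intG1 n s).map (algebraMap ℤ ℚ) = g1 n s := by
  rw [intG1, g1, Polynomial.map_sum, Finset.mul_sum]
  refine Finset.sum_congr rfl fun j hj => ?_
  rw [Finset.mem_range] at hj
  rw [Polynomial.map_mul, Polynomial.map_pow, map_X, map_C, ← mul_assoc, ← C_eq_natCast, ← C_mul]
  congr 2
  have h1 := Nat.factorial_mul_descFactorial (Nat.sub_le n j)
  rw [Nat.sub_sub_self (by omega)] at h1
  have h2 : (n - j + s).choose s = (n + s - j).choose (n - j) := by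
    rw [show n + s - j = n - j + s by omega, Nat.choose_symm_add]
  have h3 : (j.factorial : ℚ) ≠ 0 := by positivity
  rw [g1Coeff, h2, ← h1]
  simp only [eq_intCast]
  push_cast
  field_simp

theorem irreducible_g1 {n s : ℕ} (hn : 1 ≤ n) (hs : s ≤ 8) : Irreducible (g1 n s) := by
  rw [← map_intG1]
  exact (monic_intG1 n s).irreducible_iff_irreducible_map_fraction_map.mp (irreducible_intG1 hn hs)

theorem g1_irreducible_s_le_eight :
    (∀ n s : ℕ, 1 ≤ n → s ≤ 8 → Irreducible (g1 n s)) ∧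
      ∀ n : ℕ, 1 ≤ n →
        Irreducible ((n.factorial : ℚ[X]) *
          ∑ j ∈ Finset.range (n + 1),
            Polynomial.C (1 / (j.factorial : ℚ)) * Polynomial.X ^ j) := by
  refine ⟨fun n s hn hs => irreducible_g1 hn hs, fun n hn => ?_⟩
  simpa [g1] using irreducible_g1 hn (Nat.zero_le 8)
end

section
/- The polynomial g₁(x,n,s) is irreducible over ℚ for each pair (n,s) in the set T = {(272,17), (144,21), (144,23), (144,25), (144,26), (312,26), (600,26), (216,29), (216,31), (720,31), (240,35), (1440,35), (288,40), (288,41), (216,42), (216,44), (216,47), (288,47), (288,48), (216,49), (144,51), (288,51), (144,53), (216,53), (288,53), (4320,55), (216,59), (216,63), (288,63), (432,63), (672,63), (180,71), (192,71), (216,71), (216,79), (576,79), (144,80), (192,80), (216,80), (320,80), (432,80), (576,80), (720,80), (4320,80)}. -/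
open Polynomial Finset

namespace NewtonPolygon

/-! ### Indices dominating a polynomial for a `p`-adic weight -/

/-- The coefficient of `F` at `i` is the unique one minimising the weight
`B * v_p (F.coeff j) + A * j` among the nonzero coefficients. -/
def Dominates (p : ℕ) (B A : ℤ) (F : ℚ[X]) (i : ℕ) : Prop :=
  F.coeff i ≠ 0 ∧ ∀ j, F.coeff j ≠ 0 → j ≠ i →
    B * padicValRat p (F.coeff i) + A * i < B * padicValRat p (F.coeff j) + A * j

variable {p : ℕ} {A B : ℤ} {F G : ℚ[X]} {i k : ℕ}

lemma Dominates.le (h : Dominates p B A F i) {j : ℕ} (hj : F.coeff j ≠ 0) :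
    B * padicValRat p (F.coeff i) + A * i ≤ B * padicValRat p (F.coeff j) + A * j := by
  rcases eq_or_ne j i with rfl | hne
  · exact le_rfl
  · exact (h.2 j hj hne).le

lemma Dominates.unique (h : Dominates p B A F i) (h' : Dominates p B A F k) : i = k := by
  by_contra hne
  exact (h.2 k h'.1 (Ne.symm hne)).not_ge (h'.le h.1)

lemma Dominates.le_natDegree (h : Dominates p B A F i) : i ≤ F.natDegree :=
  le_natDegree_of_ne_zero h.1

lemma Dominates.mono {A' B' : ℤ} (hB : 0 ≤ B) (hB' : 0 ≤ B') (hA : A' * B < A * B')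
    (h : Dominates p B A F i) (h' : Dominates p B' A' F k) : i ≤ k := by
  have h₁ := mul_le_mul_of_nonneg_left (h.le h'.1) hB'
  have h₂ := mul_le_mul_of_nonneg_left (h'.le h.1) hB
  have h₃ : (A * B' - A' * B) * ((i : ℤ) - k) ≤ 0 := by linarith
  have : (i : ℤ) - k ≤ 0 := by
    by_contra! hlt
    exact h₃.not_gt (mul_pos (by linarith) hlt)
  lia

lemma padicValRat_sum_bound [Fact p.Prime] (hB : 0 ≤ B) {ι : Type*} {c : ℤ} (S : Finset ι)
    (f : ι → ℚ) (h : ∀ x ∈ S, f x ≠ 0 → c ≤ B * padicValRat p (f x)) :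
    ∑ x ∈ S, f x ≠ 0 → c ≤ B * padicValRat p (∑ x ∈ S, f x) := by
  classical
  induction S using Finset.induction_on with
  | empty => simp
  | insert a S ha ih =>
    rw [sum_insert ha]
    intro hne
    have hS := ih fun x hx ↦ h x (mem_insert_of_mem hx)
    have ha' := h a (mem_insert_self a S)
    by_cases h₁ : f a = 0
    · rw [h₁, zero_add] at hne ⊢
      exact hS hne
    by_cases h₂ : ∑ x ∈ S, f x = 0
    · rw [h₂, add_zero]
      exact ha' h₁
    have hmin := padicValRat.min_le_padicValRat_add (p := p) hne
    rcases min_le_iff.1 hmin with h₃ | h₃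
    · exact (ha' h₁).trans (mul_le_mul_of_nonneg_left h₃ hB)
    · exact (hS h₂).trans (mul_le_mul_of_nonneg_left h₃ hB)

lemma Dominates.mul [Fact p.Prime] (hB : 0 < B) (hF : Dominates p B A F i)
    (hG : Dominates p B A G k) : Dominates p B A (F * G) (i + k) := by
  have hterm (x : ℕ × ℕ) (hx : x ≠ (i, k)) (h0 : F.coeff x.1 * G.coeff x.2 ≠ 0) :
      B * padicValRat p (F.coeff i) + A * i + (B * padicValRat p (G.coeff k) + A * k) + 1 -
        A * (x.1 + x.2) ≤ B * padicValRat p (F.coeff x.1 * G.coeff x.2) := by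
    obtain ⟨h₁, h₂⟩ := mul_ne_zero_iff.1 h0
    rw [padicValRat.mul h₁ h₂]
    have h₃ := hF.le h₁
    have h₄ := hG.le h₂
    rcases ne_or_eq x.1 i with h | h
    · have := hF.2 _ h₁ h
      linarith
    · have := hG.2 x.2 h₂ fun h' ↦ hx (Prod.ext h h')
      linarith
  have hmain0 : F.coeff i * G.coeff k ≠ 0 := mul_ne_zero hF.1 hG.1
  have hmem : (i, k) ∈ antidiagonal (i + k) := by simp
  have hcoeff : (F * G).coeff (i + k) = F.coeff i * G.coeff k +
      ∑ x ∈ (antidiagonal (i + k)).erase (i, k), F.coeff x.1 * G.coeff x.2 := by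
    rw [coeff_mul, ← add_sum_erase _ _ hmem]
  set r := ∑ x ∈ (antidiagonal (i + k)).erase (i, k), F.coeff x.1 * G.coeff x.2
  have hrest : r ≠ 0 → padicValRat p (F.coeff i * G.coeff k) < padicValRat p r := by
    intro h0
    have := padicValRat_sum_bound (p := p) hB.le
      (c := B * padicValRat p (F.coeff i * G.coeff k) + 1) _ _ (fun x hx hx0 ↦ by
        rw [mem_erase, HasAntidiagonal.mem_antidiagonal] at hx
        have h₁ := hterm x hx.1 hx0
        have h₂ : (x.1 : ℤ) + x.2 = i + k := by exact_mod_cast hx.2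
        rw [h₂] at h₁
        rw [padicValRat.mul hF.1 hG.1]
        linarith) h0
    exact lt_of_mul_lt_mul_left (by linarith) hB.le
  have hval : (F * G).coeff (i + k) ≠ 0 ∧
      padicValRat p ((F * G).coeff (i + k)) = padicValRat p (F.coeff i * G.coeff k) := by
    rw [hcoeff]
    by_cases h0 : r = 0
    · rw [h0, add_zero]
      exact ⟨hmain0, rfl⟩
    · have hlt := hrest h0
      have hne : F.coeff i * G.coeff k + r ≠ 0 := by
        intro h
        rw [eq_neg_of_add_eq_zero_left h, padicValRat.neg] at hlt
        exact hlt.false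
      exact ⟨hne, padicValRat.add_eq_of_lt hne hmain0 h0 hlt⟩
  refine ⟨hval.1, fun j hj hjne ↦ ?_⟩
  rw [hval.2, padicValRat.mul hF.1 hG.1]
  rw [coeff_mul] at hj ⊢
  have := padicValRat_sum_bound (p := p) hB.le
    (c := B * padicValRat p (F.coeff i) + A * i + (B * padicValRat p (G.coeff k) + A * k) + 1 -
      A * j) _ _ (fun x hx hx0 ↦ by
        rw [HasAntidiagonal.mem_antidiagonal] at hx
        have h₂ : (j : ℤ) = x.1 + x.2 := by exact_mod_cast hx.symm
        rw [h₂]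
        exact hterm x (by rintro rfl; exact hjne hx.symm) hx0) hj
  push_cast
  linarith

/-! ### Edges -/

/-- An edge of a Newton polygon: the weight `b * v_p + a * j` takes its minimal value `c` exactly
between the indices `l` and `r`. -/
structure Edge where
  /-- the denominator of the slope -/
  b : ℕ
  /-- the negative of the numerator of the slope -/
  a : ℕ
  /-- the left end of the edge -/
  l : ℕ
  /-- the right end of the edge -/
  r : ℕ
  /-- the minimal weight -/
  c : ℕ

/-- `e` describes an edge of the `p`-adic Newton polygon of `F`. -/
structure Edge.IsEdgeOf (p : ℕ) (F : ℚ[X]) (e : Edge) : Prop where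
  coprime : e.b.Coprime e.a
  b_pos : 0 < e.b
  coeff_l : F.coeff e.l ≠ 0
  coeff_r : F.coeff e.r ≠ 0
  weight_l : (e.b : ℤ) * padicValRat p (F.coeff e.l) + e.a * e.l = e.c
  weight_r : (e.b : ℤ) * padicValRat p (F.coeff e.r) + e.a * e.r = e.c
  weight_ge : ∀ j, F.coeff j ≠ 0 → (e.c : ℤ) ≤ e.b * padicValRat p (F.coeff j) + e.a * j
  mem_of_eq : ∀ j, F.coeff j ≠ 0 → (e.c : ℤ) = e.b * padicValRat p (F.coeff j) + e.a * j →
    e.l ≤ j ∧ j ≤ e.r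

variable {N : ℕ} {e : Edge}

lemma exists_dominates (hF : F ≠ 0) (hN : F.natDegree < N) (b a σ : ℤ) (hσ : IsUnit σ) :
    ∃ i, Dominates p (N * b) (N * a + σ) F i := by
  obtain ⟨i, hi, hmin⟩ := F.support.exists_min_image
    (fun j ↦ N * b * padicValRat p (F.coeff j) + (N * a + σ) * j)
    (nonempty_support_iff.2 hF)
  refine ⟨i, mem_support_iff.1 hi, fun j hj hne ↦ (hmin j (mem_support_iff.2 hj)).lt_of_ne ?_⟩
  intro heq
  have hi' := le_natDegree_of_mem_supp i hi
  have hj' := le_natDegree_of_ne_zero hj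
  have hdvd : (N : ℤ) ∣ σ * (j - i) :=
    ⟨b * padicValRat p (F.coeff i) + a * i - (b * padicValRat p (F.coeff j) + a * j), by
      linear_combination -heq⟩
  rw [hσ.dvd_mul_left] at hdvd
  have := Int.eq_zero_of_abs_lt_dvd hdvd (by rw [abs_lt]; lia)
  lia

lemma Edge.IsEdgeOf.dominates_left (h : e.IsEdgeOf p F) (hN : F.natDegree < N) :
    Dominates p (N * e.b) (N * e.a + 1) F e.l := by
  refine ⟨h.coeff_l, fun j hj hne ↦ ?_⟩
  have hl := le_natDegree_of_ne_zero h.coeff_l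
  have hw := h.weight_l
  rcases (h.weight_ge j hj).lt_or_eq with hlt | heq
  · have := mul_le_mul_of_nonneg_left (Int.add_one_le_of_lt hlt) (Int.natCast_nonneg N)
    rw [← hw] at this
    have : (e.l : ℤ) < N := by lia
    linarith
  · have := (h.mem_of_eq j hj heq).1
    have : (e.l : ℤ) < j := by lia
    linear_combination this + N * heq + N * hw

lemma Edge.IsEdgeOf.dominates_right (h : e.IsEdgeOf p F) (hN : F.natDegree < N) :
    Dominates p (N * e.b) (N * e.a + -1) F e.r := by
  refine ⟨h.coeff_r, fun j hj hne ↦ ?_⟩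
  have hj' := le_natDegree_of_ne_zero hj
  have hw := h.weight_r
  rcases (h.weight_ge j hj).lt_or_eq with hlt | heq
  · have := mul_le_mul_of_nonneg_left (Int.add_one_le_of_lt hlt) (Int.natCast_nonneg N)
    rw [← hw] at this
    have : (j : ℤ) < N := by lia
    linarith
  · have := (h.mem_of_eq j hj heq).2
    have : (j : ℤ) < e.r := by lia
    linear_combination this + N * heq + N * hw

/-- The two ends of the segment of `F` along a slope `-a / b` in lowest terms are ordered, and
differ by a multiple of `b`. -/
lemma Dominates.left_right {a b l r : ℕ} (hab : b.Coprime a) (hN : F.natDegree < N)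
    (hl : Dominates p (N * b) (N * a + 1) F l) (hr : Dominates p (N * b) (N * a + -1) F r) :
    ∃ k, r = l + k * b := by
  have h₁ := hl.le hr.1
  have h₂ := hr.le hl.1
  have hlN : (l : ℤ) < N := by have := hl.le_natDegree; lia
  have hrN : (r : ℤ) < N := by have := hr.le_natDegree; lia
  have hle : l ≤ r := by
    have : (l : ℤ) ≤ r := by linarith
    lia
  have hN0 : (0 : ℤ) < N := by lia
  set x := b * padicValRat p (F.coeff l) + a * l
  set y := b * padicValRat p (F.coeff r) + a * r
  have h₃ : N * (x - y) < N * 1 := by linarith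
  have h₄ : N * (y - x) < N * 1 := by linarith
  have h₅ := lt_of_mul_lt_mul_left h₃ hN0.le
  have h₆ := lt_of_mul_lt_mul_left h₄ hN0.le
  have hxy : x = y := by lia
  have hdvd : (b : ℤ) ∣ a * ((r - l : ℕ) : ℤ) := by
    refine ⟨padicValRat p (F.coeff l) - padicValRat p (F.coeff r), ?_⟩
    push_cast [hle]
    linear_combination -hxy
  have hdvd' : b ∣ r - l := hab.dvd_of_dvd_mul_left (by exact_mod_cast hdvd)
  obtain ⟨k, hk⟩ := hdvd'
  exact ⟨k, by rw [mul_comm, ← hk]; lia⟩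

/-! ### Possible degrees of factors, as bit masks -/

/-- The bits of `M`, shifted by `0, d, …, m * d`; the first argument is fuel. -/
def spread (d : ℕ) : ℕ → ℕ → ℕ → ℕ
  | 0, M, _ => M
  | t + 1, M, m =>
    match m with
    | 0 => M
    | m + 1 => spread d t M ((m + 1) / 2) |||
        (spread d t M ((m + 1) / 2) <<< (d * (m + 1 - (m + 1) / 2)))

lemma testBit_spread {d M i : ℕ} (hi : M.testBit i) (t : ℕ) : ∀ m ≤ t, ∀ k ≤ m,
    (spread d t M m).testBit (i + k * d) := by
  induction t with
  | zero =>
    intro m hm k hk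
    obtain rfl : k = 0 := by lia
    simpa [spread] using hi
  | succ t ih =>
    intro m hm k hk
    match m with
    | 0 =>
      obtain rfl : k = 0 := by lia
      simpa [spread] using hi
    | m + 1 =>
      rw [spread, Nat.testBit_or, Bool.or_eq_true]
      rcases le_or_gt k ((m + 1) / 2) with h | h
      · exact Or.inl (ih _ (by lia) k h)
      · right
        have hk' : m + 1 - (m + 1) / 2 ≤ k := by lia
        have := ih ((m + 1) / 2) (by lia) (k - (m + 1 - (m + 1) / 2)) (by lia)
        have heq : i + k * d =
            i + (k - (m + 1 - (m + 1) / 2)) * d + d * (m + 1 - (m + 1) / 2) := by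
          obtain ⟨u, rfl⟩ := Nat.exists_eq_add_of_le hk'
          rw [Nat.add_sub_cancel_left]
          ring
        rw [Nat.testBit_shiftLeft, heq, Nat.add_sub_cancel]
        simpa using this

/-- A mask containing the degrees of all factors of a polynomial of degree `n` whose Newton polygon
has the given edges, starting at `pos` from the possible indices `M`. -/
def degreeMask (n : ℕ) : List Edge → ℕ → ℕ → ℕ
  | [], pos, M => spread 1 (n - pos) M (n - pos)
  | e :: es, pos, M => degreeMask n es e.r
      (spread e.b ((e.r - e.l) / e.b) (spread 1 (e.l - pos) M (e.l - pos)) ((e.r - e.l) / e.b))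

lemma testBit_degreeMask_aux [Fact p.Prime] (hF : F ≠ 0) (hG : G ≠ 0)
    (hN : (F * G).natDegree < N) (es : List Edge) (hes : ∀ e ∈ es, e.IsEdgeOf p (F * G))
    (hb : ∀ e ∈ es, 2 * e.b < N) (hsort : es.Pairwise fun e e' ↦ e'.a * e.b < e.a * e'.b) :
    ∀ pos M i k, i + k = pos → M.testBit i → i ≤ F.natDegree → k ≤ G.natDegree →
      (∀ e ∈ es, ∀ u, Dominates p (N * e.b) (N * e.a + 1) F u → i ≤ u) →
      (∀ e ∈ es, ∀ u, Dominates p (N * e.b) (N * e.a + 1) G u → k ≤ u) →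
      (degreeMask (F * G).natDegree es pos M).testBit F.natDegree := by
  have hdeg := natDegree_mul hF hG
  have hFN : F.natDegree < N := by lia
  have hGN : G.natDegree < N := by lia
  induction es with
  | nil =>
    intro pos M i k hpos hM hi hk _ _
    have := testBit_spread (d := 1) hM ((F * G).natDegree - pos) _ le_rfl (F.natDegree - i)
      (by lia)
    rwa [mul_one, Nat.add_sub_cancel' hi] at this
  | cons e es ih =>
    intro pos M i k hpos hM hi hk hlowF hlowG
    rw [List.pairwise_cons] at hsort
    simp only [List.mem_cons, forall_eq_or_imp] at hes hb hlowF hlowG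
    have hB : (0 : ℤ) < N * e.b := by
      have := hes.1.b_pos
      exact_mod_cast Nat.mul_pos (by lia) this
    obtain ⟨lF, hlF⟩ := exists_dominates (p := p) hF hFN e.b e.a 1 isUnit_one
    obtain ⟨lG, hlG⟩ := exists_dominates (p := p) hG hGN e.b e.a 1 isUnit_one
    obtain ⟨rF, hrF⟩ := exists_dominates (p := p) hF hFN e.b e.a (-1) isUnit_one.neg
    obtain ⟨rG, hrG⟩ := exists_dominates (p := p) hG hGN e.b e.a (-1) isUnit_one.neg
    have hl := (hlF.mul hB hlG).unique (hes.1.dominates_left hN)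
    have hr := (hrF.mul hB hrG).unique (hes.1.dominates_right hN)
    obtain ⟨kF, hkF⟩ := hlF.left_right hes.1.coprime hFN hrF
    obtain ⟨kG, hkG⟩ := hlG.left_right hes.1.coprime hGN hrG
    have hiF := hlowF.1 lF hlF
    have hiG := hlowG.1 lG hlG
    have hmono {H : ℚ[X]} {v : ℕ} (hv : Dominates p (N * e.b) (N * e.a + -1) H v) :
        ∀ e' ∈ es, ∀ u, Dominates p (N * e'.b) (N * e'.a + 1) H u → v ≤ u := by
      intro e' he' u hu
      refine hv.mono hB.le (by positivity) ?_ hu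
      have h₁ : (e'.a : ℤ) * e.b + 1 ≤ e.a * e'.b := by exact_mod_cast hsort.1 e' he'
      have h₂ : (e.b : ℤ) + e'.b < N := by
        have := hb.1
        have := hb.2 e' he'
        lia
      have hN0 : (0 : ℤ) < N := by lia
      have h₃ := mul_le_mul_of_nonneg_left h₁ hN0.le
      have h₄ := mul_lt_mul_of_pos_left (show (N * (e'.a * e.b) + (e.b + e'.b) : ℤ) <
        N * (e.a * e'.b) by linarith) hN0
      linarith
    refine ih hes.2 hb.2 hsort.2 e.r _ rF rG hr ?_ hrF.le_natDegree hrG.le_natDegree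
      (hmono hrF) (hmono hrG)
    have h₁ := testBit_spread (d := 1) hM (e.l - pos) _ le_rfl (lF - i) (by lia)
    rw [mul_one, Nat.add_sub_cancel' hiF] at h₁
    rw [hkF]
    refine testBit_spread h₁ _ _ le_rfl kF ?_
    rw [Nat.le_div_iff_mul_le hes.1.b_pos]
    lia

/-- The degree of a factor is compatible with the edges of the Newton polygon. -/
theorem testBit_degreeMask [Fact p.Prime] (hF : F ≠ 0) (hG : G ≠ 0) (es : List Edge)
    (hes : ∀ e ∈ es, e.IsEdgeOf p (F * G))
    (hsort : es.Pairwise fun e e' ↦ e'.a * e.b < e.a * e'.b) :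
    (degreeMask (F * G).natDegree es 0 1).testBit F.natDegree := by
  refine testBit_degreeMask_aux (N := (F * G).natDegree + 2 * (es.map Edge.b).sum + 1) hF hG
    (by lia) es hes (fun e he ↦ ?_) hsort 0 1 0 0 rfl rfl (Nat.zero_le _) (Nat.zero_le _)
    (fun _ _ _ _ ↦ Nat.zero_le _) (fun _ _ _ _ ↦ Nat.zero_le _)
  have := List.le_sum_of_mem (List.mem_map_of_mem (f := Edge.b) he)
  lia

end NewtonPolygon

namespace G1

/-! ### Positivity -/

/-- The polynomial function `g1 n s`, divided by `n!`, over the reals. -/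
noncomputable def realFun (n s : ℕ) (x : ℝ) : ℝ :=
  ∑ j ∈ range (n + 1), ((n + s - j).choose (n - j) : ℝ) / j.factorial * x ^ j

lemma hasDerivAt_realFun (n s : ℕ) (x : ℝ) :
    HasDerivAt (realFun (n + 1) s) (realFun n s x) x := by
  have h : HasDerivAt (realFun (n + 1) s) (∑ j ∈ range (n + 2),
      ((n + 1 + s - j).choose (n + 1 - j) : ℝ) / j.factorial * (j * x ^ (j - 1))) x :=
    HasDerivAt.fun_sum fun j _ ↦ (hasDerivAt_pow j x).const_mul _
  convert h using 1
  rw [sum_range_succ', realFun]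
  simp only [Nat.cast_zero, zero_mul, mul_zero, add_zero, Nat.add_sub_cancel]
  refine sum_congr rfl fun j _ ↦ ?_
  rw [show n + 1 + s - (j + 1) = n + s - j by lia, show n + 1 - (j + 1) = n - j by lia,
    Nat.factorial_succ]
  push_cast
  field_simp

lemma realFun_succ_zero (n : ℕ) (x : ℝ) :
    realFun (n + 1) 0 x = realFun n 0 x + x ^ (n + 1) / (n + 1).factorial := by
  simp only [realFun, add_zero, Nat.choose_self, Nat.cast_one]
  rw [sum_range_succ]
  ring

lemma realFun_succ_succ (n s : ℕ) (x : ℝ) :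
    realFun (n + 1) (s + 1) x = realFun n (s + 1) x + realFun (n + 1) s x := by
  rw [realFun, realFun, realFun, sum_range_succ, sum_range_succ _ (n + 1), ← add_assoc (∑ _ ∈ _, _),
    ← sum_add_distrib]
  congr 1
  · refine sum_congr rfl fun j hj ↦ ?_
    have hj' : j ≤ n := by simpa [Nat.lt_succ_iff] using hj
    rw [show n + 1 + (s + 1) - j = n + (s + 1) - j + 1 by lia,
      show n + 1 - j = n - j + 1 by lia, Nat.choose_succ_succ,
      show n + 1 + s - j = n + (s + 1) - j by lia]
    push_cast
    ring
  · simp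

lemma realFun_pos_of_nonneg (n s : ℕ) {x : ℝ} (hx : 0 ≤ x) : 0 < realFun n s x := by
  rw [realFun, sum_range_succ']
  have : 0 < (n + s).choose n := Nat.choose_pos (by lia)
  simp only [Nat.factorial_zero, pow_zero, Nat.sub_zero]
  positivity

lemma realFun_pos_of_le {m s : ℕ} (hle : ∀ y, realFun m s y ≤ realFun (m + 1) s y) (x : ℝ) :
    0 < realFun (m + 1) s x := by
  rcases le_total 0 x with hx | hx
  · exact realFun_pos_of_nonneg (m + 1) s hx
  have hderiv (y : ℝ) : HasDerivAt (fun y ↦ Real.exp (-y) * realFun (m + 1) s y)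
      (Real.exp (-y) * (realFun m s y - realFun (m + 1) s y)) y :=
    ((hasDerivAt_neg y).exp.mul (hasDerivAt_realFun m s y)).congr_deriv (by ring)
  have hanti : Antitone fun y ↦ Real.exp (-y) * realFun (m + 1) s y :=
    antitone_of_hasDerivAt_nonpos hderiv fun y ↦
      mul_nonpos_of_nonneg_of_nonpos (Real.exp_pos _).le (by linarith [hle y])
  have h₁ := (mul_pos (Real.exp_pos (-0)) (realFun_pos_of_nonneg (m + 1) s le_rfl)).trans_le
    (hanti hx)
  exact pos_of_mul_pos_right h₁ (Real.exp_pos _).le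

/-- For even `n` the polynomial has no real zero. -/
lemma realFun_pos {n : ℕ} (hn : Even n) (s : ℕ) (x : ℝ) : 0 < realFun n s x := by
  obtain _ | m := n
  · simp [realFun]
  induction s generalizing x with
  | zero =>
    refine realFun_pos_of_le (fun y ↦ ?_) x
    have := hn.pow_nonneg y
    rw [realFun_succ_zero]
    have : 0 ≤ y ^ (m + 1) / (m + 1).factorial := by positivity
    linarith
  | succ s ih =>
    refine realFun_pos_of_le (fun y ↦ ?_) x
    rw [realFun_succ_succ]
    linarith [ih y]

/-! ### Coefficients -/

lemma coeff_g1 (n s j : ℕ) : (g1 n s).coeff j = if j ≤ n then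
    (n.factorial * (n + s - j).factorial : ℚ) / (j.factorial * (n - j).factorial * s.factorial)
    else 0 := by
  have h : (n.factorial : ℚ[X]) = C (n.factorial : ℚ) := by simp
  rw [g1, h, coeff_C_mul, finsetSum_coeff]
  simp only [coeff_C_mul_X_pow, sum_ite_eq, mem_range, Nat.lt_succ_iff]
  split_ifs with hj
  · rw [Nat.cast_choose ℚ (by lia), show n + s - j - (n - j) = s by lia]
    field_simp
  · simp

lemma natDegree_g1 (n s : ℕ) : (g1 n s).natDegree = n := by
  refine natDegree_eq_of_le_of_coeff_ne_zero ?_ ?_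
  · rw [natDegree_le_iff_coeff_eq_zero]
    intro j hj
    rw [coeff_g1, if_neg (by lia)]
  · rw [coeff_g1, if_pos le_rfl]
    positivity

lemma eval_g1_ne_zero {n : ℕ} (hn : Even n) (s : ℕ) (x : ℚ) : (g1 n s).eval x ≠ 0 := by
  have h : (((g1 n s).eval x : ℚ) : ℝ) = n.factorial * realFun n s x := by
    rw [g1, realFun]
    simp [eval_finsetSum]
  have : (0 : ℝ) < n.factorial * realFun n s x := by
    have := realFun_pos hn s x
    positivity
  rw [← h] at this
  exact_mod_cast this.ne'

open NewtonPolygon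

/-! ### A checkable certificate -/

/-- `k x`, arranged so that evaluation computes `x` before passing it to `k`. -/
def withValue (x : ℕ) (k : ℕ → Bool) : Bool :=
  match x with
  | 0 => k 0
  | y + 1 => k (y + 1)

lemma withValue_eq (x : ℕ) (k : ℕ → Bool) : withValue x k = k x := by
  cases x <;> rfl

/-- `f j` holds for all `j < n`. -/
def allBelow (f : ℕ → Bool) : ℕ → Bool
  | 0 => true
  | n + 1 => f n && allBelow f n

lemma of_allBelow {f : ℕ → Bool} {n : ℕ} (h : allBelow f n) : ∀ j < n, f j := by
  induction n with
  | zero => simp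
  | succ n ih =>
    rw [allBelow, Bool.and_eq_true] at h
    intro j hj
    rcases Nat.lt_succ_iff_lt_or_eq.1 hj with hj | rfl
    · exact ih h.2 j hj
    · exact h.1

/-- The exponent of `p` in `m!`, by Legendre's formula; the first argument is fuel. -/
def factorialVal (p : ℕ) : ℕ → ℕ → ℕ
  | 0, _ => 0
  | t + 1, m =>
    match m / p with
    | 0 => 0
    | q + 1 => q + 1 + factorialVal p t (q + 1)

lemma factorialVal_eq (p : ℕ) [hp : Fact p.Prime] (t : ℕ) : ∀ m ≤ t,
    factorialVal p t m = padicValNat p m.factorial := by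
  induction t with
  | zero =>
    intro m hm
    obtain rfl : m = 0 := by lia
    simp [factorialVal]
  | succ t ih =>
    intro m hm
    rw [factorialVal, ← padicValNat_mul_div_factorial, padicValNat_factorial_mul]
    have hle : m / p ≤ t := by
      rcases Nat.eq_zero_or_pos m with rfl | hm0
      · simp
      · have := Nat.div_lt_self hm0 hp.out.one_lt
        lia
    split
    next h => simp [h]
    next q h =>
      rw [h] at hle ⊢
      rw [ih _ hle, add_comm]

/-- The positive part of the exponent of `p` in the coefficient of `g1 n s` at `j`. -/
def numVal (p n s j : ℕ) : ℕ := factorialVal p n n + factorialVal p (n + s - j) (n + s - j)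

/-- The negative part of the exponent of `p` in the coefficient of `g1 n s` at `j`. -/
def denVal (p n s j : ℕ) : ℕ :=
  factorialVal p j j + factorialVal p (n - j) (n - j) + factorialVal p s s

lemma padicValRat_coeff_g1 (p : ℕ) [Fact p.Prime] {n j : ℕ} (s : ℕ) (hj : j ≤ n) :
    padicValRat p ((g1 n s).coeff j) = (numVal p n s j : ℤ) - denVal p n s j := by
  have h (m : ℕ) : padicValRat p (m.factorial : ℚ) = factorialVal p m m := by
    rw [padicValRat.of_nat, factorialVal_eq p m m le_rfl]
  have h0 (m : ℕ) : (m.factorial : ℚ) ≠ 0 := by positivity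
  rw [coeff_g1, if_pos hj, padicValRat.div (mul_ne_zero (h0 _) (h0 _))
    (mul_ne_zero (mul_ne_zero (h0 _) (h0 _)) (h0 _)), padicValRat.mul (h0 _) (h0 _),
    padicValRat.mul (mul_ne_zero (h0 _) (h0 _)) (h0 _), padicValRat.mul (h0 _) (h0 _),
    h, h, h, h, h, numVal, denVal]
  push_cast
  ring

/-- The edge `e` lies below the point of abscissa `j` and exponent `P - Q`, strictly if `j` is
outside the edge. -/
def edgeBelow (j P Q : ℕ) (e : Edge) : Bool :=
  Nat.ble (e.c + e.b * Q + (1 - (Nat.ble e.l j && Nat.ble j e.r).toNat)) (e.b * P + e.a * j)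

/-- The edge `e` passes through the point of abscissa `j` and exponent `P - Q`. -/
def edgeThrough (j P Q : ℕ) (e : Edge) : Bool := e.c + e.b * Q == e.b * P + e.a * j

/-- The checks on a single edge. -/
def checkEdge (p n s : ℕ) (e : Edge) : Bool :=
  Nat.gcd e.b e.a == 1 && Nat.ble 1 e.b && Nat.ble e.l n && Nat.ble e.r n &&
    edgeThrough e.l (numVal p n s e.l) (denVal p n s e.l) e &&
    edgeThrough e.r (numVal p n s e.r) (denVal p n s e.r) e

/-- All edges lie below the Newton polygon of `g1 n s`. -/
def checkBelow (p n s : ℕ) (es : List Edge) : Bool :=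
  allBelow (fun j ↦ withValue (numVal p n s j) fun P ↦ withValue (denVal p n s j) fun Q ↦
    es.all (edgeBelow j P Q)) (n + 1)

/-- The slopes increase along the list. -/
def checkSlopes : List Edge → Bool
  | [] => true
  | e :: es => es.all (fun e' ↦ Nat.blt (e'.a * e.b) (e.a * e'.b)) && checkSlopes es

/-- `p` is prime. -/
def checkPrime (p : ℕ) : Bool :=
  Nat.ble 2 p && allBelow (fun m ↦ Nat.ble m 1 || Nat.blt 0 (p % m)) p

/-- `es` is a list of edges of the `p`-adic Newton polygon of `g1 n s`. -/
def checkPolygon (n s : ℕ) (c : ℕ × List Edge) : Bool :=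
  checkPrime c.1 && checkSlopes c.2 && c.2.all (checkEdge c.1 n s) && checkBelow c.1 n s c.2

/-- The edges in `cs` exclude all factors of degree between `2` and `n - 2`. -/
def checkIrreducible (n s : ℕ) (cs : List (ℕ × List Edge)) : Bool :=
  n % 2 == 0 && Nat.ble 1 n && cs.all (checkPolygon n s) &&
    withValue (cs.foldr (fun c M ↦ degreeMask n c.2 0 1 &&& M) (2 ^ (n + 1) - 1)) fun M ↦
      Nat.ble M (M &&& (3 + 3 * 2 ^ (n - 1)))

lemma prime_of_checkPrime {p : ℕ} (h : checkPrime p) : p.Prime := by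
  rw [checkPrime, Bool.and_eq_true, Nat.ble_eq] at h
  rw [Nat.prime_def_lt]
  refine ⟨h.1, fun m hm hdvd ↦ ?_⟩
  have h₁ := of_allBelow h.2 m hm
  rw [Nat.mod_eq_zero_of_dvd hdvd, Bool.or_eq_true, Nat.ble_eq] at h₁
  have h₂ := Nat.pos_of_dvd_of_pos hdvd (by lia)
  rcases h₁ with h₁ | h₁
  · lia
  · simp at h₁

lemma pairwise_of_checkSlopes {es : List Edge} (h : checkSlopes es) :
    es.Pairwise fun e e' ↦ e'.a * e.b < e.a * e'.b := by
  induction es with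
  | nil => exact List.Pairwise.nil
  | cons e es ih =>
    rw [checkSlopes, Bool.and_eq_true, List.all_eq_true] at h
    exact List.Pairwise.cons (fun e' he' ↦ by simpa using h.1 e' he') (ih h.2)

lemma isEdgeOf_of_check {p n s : ℕ} [Fact p.Prime] {es : List Edge} {e : Edge} (he : e ∈ es)
    (h : checkEdge p n s e) (h' : checkBelow p n s es) : e.IsEdgeOf p (g1 n s) := by
  simp only [checkEdge, edgeThrough, Bool.and_eq_true, beq_iff_eq, Nat.ble_eq] at h
  obtain ⟨⟨⟨⟨⟨hgcd, hb⟩, hl⟩, hr⟩, hwl⟩, hwr⟩ := h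
  have hcoeff {j : ℕ} (hj : (g1 n s).coeff j ≠ 0) : j ≤ n := by
    by_contra hjn
    rw [coeff_g1, if_neg hjn] at hj
    exact hj rfl
  have hne {j : ℕ} (hj : j ≤ n) : (g1 n s).coeff j ≠ 0 := by
    rw [coeff_g1, if_pos hj]
    positivity
  have hbelow {j : ℕ} (hj : j ≤ n) := of_allBelow h' j (by lia)
  simp only [withValue_eq, List.all_eq_true, edgeBelow, Nat.ble_eq] at hbelow
  refine ⟨hgcd, hb, hne hl, hne hr, ?_, ?_, fun j hj ↦ ?_, fun j hj heq ↦ ?_⟩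
  · rw [padicValRat_coeff_g1 p s hl]
    zify at hwl
    linear_combination -hwl
  · rw [padicValRat_coeff_g1 p s hr]
    zify at hwr
    linear_combination -hwr
  · have h₁ := (Nat.le_add_right _ _).trans (hbelow (hcoeff hj) e he)
    rw [padicValRat_coeff_g1 p s (hcoeff hj)]
    zify at h₁
    linear_combination h₁
  · have h₁ := hbelow (hcoeff hj) e he
    rw [padicValRat_coeff_g1 p s (hcoeff hj)] at heq
    have h₂ : e.c + e.b * denVal p n s j = e.b * numVal p n s j + e.a * j := by
      zify
      linear_combination heq
    rw [h₂] at h₁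
    by_contra hlr
    have h₃ : (Nat.ble e.l j && Nat.ble j e.r) = false := by
      rw [Bool.eq_false_iff]
      simpa using hlr
    rw [h₃, Bool.toNat_false] at h₁
    lia

lemma testBit_foldr_land {ι : Type*} {cs : List ι} {f : ι → ℕ} {M k : ℕ} (hM : M.testBit k)
    (h : ∀ c ∈ cs, (f c).testBit k) : (cs.foldr (fun c M ↦ f c &&& M) M).testBit k := by
  induction cs with
  | nil => exact hM
  | cons c cs ih =>
    rw [List.foldr_cons, Nat.testBit_and, Bool.and_eq_true]
    exact ⟨h c List.mem_cons_self, ih fun c' hc' ↦ h c' (List.mem_cons_of_mem c hc')⟩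

lemma natDegree_ne_one {n : ℕ} (hn : Even n) {s : ℕ} {F G : ℚ[X]} (hFG : g1 n s = F * G) :
    F.natDegree ≠ 1 := by
  intro h
  obtain ⟨x, hx⟩ := exists_root_of_degree_eq_one (degree_eq_iff_natDegree_eq_of_pos one_pos |>.2 h)
  refine eval_g1_ne_zero hn s x ?_
  rw [hFG, eval_mul, hx.eq_zero, zero_mul]

theorem irreducible_of_check {n s : ℕ} (cs : List (ℕ × List Edge))
    (h : checkIrreducible n s cs) : Irreducible (g1 n s) := by
  simp only [checkIrreducible, withValue_eq, Bool.and_eq_true, beq_iff_eq, Nat.ble_eq,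
    List.all_eq_true] at h
  obtain ⟨⟨⟨hn, hn1⟩, hcs⟩, hmask⟩ := h
  have hdeg := natDegree_g1 n s
  have hne : g1 n s ≠ 0 := by
    rintro h0
    rw [h0, natDegree_zero] at hdeg
    lia
  refine ⟨fun hu ↦ ?_, fun F G hFG ↦ ?_⟩
  · rw [natDegree_eq_zero_of_isUnit hu] at hdeg
    lia
  have hF : F ≠ 0 := by rintro rfl; simp_all
  have hG : G ≠ 0 := by rintro rfl; simp_all
  have hsum : F.natDegree + G.natDegree = n := by rw [← natDegree_mul hF hG, ← hFG, hdeg]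
  set M := cs.foldr (fun c M ↦ degreeMask n c.2 0 1 &&& M) (2 ^ (n + 1) - 1)
  have hbit : M.testBit F.natDegree := by
    refine testBit_foldr_land (f := fun c : ℕ × List Edge ↦ degreeMask n c.2 0 1) ?_
      fun c hc ↦ ?_
    · rw [Nat.testBit_two_pow_sub_one, decide_eq_true_eq]
      lia
    · have hc' := hcs c hc
      simp only [checkPolygon, Bool.and_eq_true, List.all_eq_true] at hc'
      obtain ⟨⟨⟨hp, hslopes⟩, hedges⟩, hbelow⟩ := hc'
      have := Fact.mk (prime_of_checkPrime hp)
      have hmask := testBit_degreeMask (p := c.1) hF hG c.2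
        (fun e he ↦ hFG ▸ isEdgeOf_of_check he (hedges e he) hbelow)
        (pairwise_of_checkSlopes hslopes)
      rwa [← hFG, hdeg] at hmask
  rw [le_antisymm hmask Nat.and_le_left, Nat.testBit_and, Bool.and_eq_true] at hbit
  have hk : F.natDegree ≤ 1 ∨ n - 1 ≤ F.natDegree := by
    by_contra! hlt
    have h₁ := hbit.2
    rw [show 3 * 2 ^ (n - 1) = 2 ^ (n - 1) * 3 by ring, add_comm,
      Nat.testBit_two_pow_mul_add _ ((show 3 < 2 ^ 2 by norm_num).trans_le
        (Nat.pow_le_pow_right two_pos (by lia))), if_pos hlt.2] at h₁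
    have := Nat.testBit_lt_two_pow (x := 3) (i := F.natDegree)
      ((show 3 < 2 ^ 2 by norm_num).trans_le (Nat.pow_le_pow_right two_pos (by lia)))
    simp_all
  have hF1 := natDegree_ne_one (Nat.even_iff.2 hn) hFG
  have hG1 := natDegree_ne_one (Nat.even_iff.2 hn) (hFG.trans (mul_comm F G))
  have : F.natDegree = 0 ∨ G.natDegree = 0 := by lia
  refine this.imp (fun h0 ↦ ?_) fun h0 ↦ ?_
  · exact isUnit_iff_degree_eq_zero.2 (by rw [degree_eq_natDegree hF, h0]; rfl)
  · exact isUnit_iff_degree_eq_zero.2 (by rw [degree_eq_natDegree hG, h0]; rfl)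

/-- For each pair `(n, s)`, primes and edges of Newton polygons of `g1 n s`. -/
def certificates : List ((ℕ × ℕ) × List (ℕ × List Edge)) := [
  ((272, 17), [
      (3, [⟨243, 121, 2, 245, 32804⟩, ⟨27, 13, 245, 272, 3536⟩]),
      (17, [⟨16, 1, 1, 17, 257⟩, ⟨17, 1, 17, 272, 272⟩])]),
  ((144, 21), [
      (5, [⟨15, 4, 1, 16, 529⟩, ⟨125, 31, 16, 141, 4371⟩]),
      (13, [⟨13, 1, 0, 143, 143⟩])]),
  ((144, 23), [
      (5, [⟨15, 4, 3, 18, 537⟩, ⟨125, 31, 18, 143, 4433⟩]),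
      (13, [⟨13, 1, 0, 143, 143⟩])]),
  ((144, 25), [
      (11, [⟨121, 12, 0, 121, 1694⟩, ⟨11, 1, 121, 143, 143⟩]),
      (13, [⟨13, 1, 1, 144, 144⟩])]),
  ((144, 26), [
      (3, [⟨81, 40, 9, 90, 5706⟩, ⟨27, 13, 90, 144, 1872⟩]),
      (11, [⟨121, 12, 0, 121, 1694⟩, ⟨11, 1, 121, 143, 143⟩])]),
  ((312, 26), [
      (13, [⟨12, 1, 1, 13, 301⟩, ⟨169, 14, 13, 182, 4238⟩, ⟨13, 1, 182, 312, 312⟩]),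
      (17, [⟨289, 18, 0, 289, 5491⟩, ⟨17, 1, 289, 306, 306⟩])]),
  ((600, 26), [
      (3, [⟨3, 2, 0, 6, 897⟩, ⟨243, 121, 6, 492, 72411⟩, ⟨81, 40, 492, 573, 23973⟩,
        ⟨27, 13, 573, 600, 7800⟩]),
      (23, [⟨529, 24, 0, 529, 14283⟩, ⟨23, 1, 529, 598, 598⟩])]),
  ((216, 29), [
      (2, [⟨128, 127, 24, 152, 27368⟩, ⟨64, 63, 152, 216, 13608⟩]),
      (31, [⟨29, 1, 0, 29, 203⟩, ⟨31, 1, 29, 215, 215⟩])]),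
  ((216, 31), [
      (5, [⟨125, 31, 0, 125, 6500⟩, ⟨25, 6, 125, 200, 1275⟩, ⟨5, 1, 200, 215, 215⟩]),
      (13, [⟨169, 14, 1, 170, 2887⟩, ⟨13, 1, 170, 209, 209⟩]),
      (17, [⟨10, 1, 0, 10, 130⟩, ⟨17, 1, 10, 214, 214⟩])]),
  ((720, 31), [
      (3, [⟨27, 16, 0, 27, 9693⟩, ⟨243, 121, 27, 513, 86616⟩, ⟨81, 40, 513, 675, 28701⟩,
        ⟨27, 13, 675, 702, 9342⟩, ⟨9, 4, 702, 720, 2880⟩]),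
      (7, [⟨343, 57, 17, 703, 40757⟩]),
      (31, [⟨31, 1, 0, 713, 713⟩])]),
  ((240, 35), [
      (2, [⟨16, 17, 0, 32, 3824⟩, ⟨128, 127, 32, 160, 30304⟩, ⟨64, 63, 160, 224, 15072⟩,
        ⟨16, 15, 224, 240, 3600⟩]),
      (17, [⟨17, 1, 0, 238, 238⟩])]),
  ((1440, 35), [
      (7, [⟨343, 57, 7, 1379, 81690⟩, ⟨49, 8, 1379, 1428, 11473⟩]),
      (37, [⟨33, 1, 0, 33, 1320⟩, ⟨1369, 38, 33, 1402, 54645⟩, ⟨37, 1, 1402, 1439, 1439⟩])]),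
  ((288, 40), [
      (2, [⟨256, 255, 32, 288, 73440⟩]),
      (7, [⟨35, 6, 0, 35, 1645⟩, ⟨49, 8, 35, 280, 2289⟩, ⟨7, 1, 280, 287, 287⟩]),
      (19, [⟨19, 1, 0, 285, 285⟩])]),
  ((288, 41), [
      (2, [⟨256, 255, 32, 288, 73440⟩]),
      (7, [⟨35, 6, 1, 36, 1651⟩, ⟨49, 8, 36, 281, 2297⟩, ⟨7, 1, 281, 288, 288⟩]),
      (19, [⟨19, 1, 0, 285, 285⟩])]),
  ((216, 42), [
      (3, [⟨9, 5, 0, 27, 972⟩, ⟨81, 40, 27, 189, 8613⟩, ⟨27, 13, 189, 216, 2808⟩]),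
      (13, [⟨169, 14, 0, 169, 2873⟩, ⟨13, 1, 169, 208, 208⟩]),
      (29, [⟨29, 1, 0, 203, 203⟩])]),
  ((216, 44), [
      (2, [⟨5, 8, 0, 5, 1085⟩, ⟨3, 4, 5, 8, 647⟩, ⟨128, 127, 8, 136, 27256⟩,
        ⟨64, 63, 136, 200, 13560⟩, ⟨16, 15, 200, 216, 3240⟩]),
      (3, [⟨9, 5, 0, 27, 972⟩, ⟨81, 40, 27, 189, 8613⟩, ⟨27, 13, 189, 216, 2808⟩])]),
  ((216, 47), [
      (7, [⟨19, 4, 0, 19, 684⟩, ⟨49, 8, 19, 215, 1720⟩]),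
      (13, [⟨169, 14, 4, 173, 2929⟩]),
      (23, [⟨23, 1, 0, 207, 207⟩])]),
  ((288, 47), [
      (3, [⟨243, 121, 18, 261, 34740⟩, ⟨27, 13, 261, 288, 3744⟩]),
      (7, [⟨6, 1, 0, 42, 282⟩, ⟨49, 8, 42, 287, 2296⟩]),
      (19, [⟨19, 1, 0, 285, 285⟩])]),
  ((288, 48), [
      (3, [⟨9, 5, 0, 18, 1296⟩, ⟨243, 121, 18, 261, 34740⟩, ⟨27, 13, 261, 288, 3744⟩]),
      (19, [⟨19, 1, 0, 285, 285⟩])]),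
  ((216, 49), [
      (3, [⟨9, 5, 0, 27, 972⟩, ⟨81, 40, 27, 189, 8613⟩, ⟨27, 13, 189, 216, 2808⟩]),
      (13, [⟨169, 14, 6, 175, 2957⟩, ⟨13, 1, 175, 214, 214⟩]),
      (29, [⟨29, 1, 5, 208, 208⟩])]),
  ((144, 51), [
      (11, [⟨121, 12, 0, 121, 1694⟩, ⟨11, 1, 121, 143, 143⟩]),
      (13, [⟨26, 3, 1, 27, 315⟩, ⟨13, 1, 27, 144, 144⟩])]),
  ((288, 51), [
      (3, [⟨9, 5, 0, 18, 1296⟩, ⟨243, 121, 18, 261, 34740⟩, ⟨27, 13, 261, 288, 3744⟩]),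
      (19, [⟨19, 1, 0, 285, 285⟩])]),
  ((144, 53), [
      (11, [⟨121, 12, 0, 121, 1694⟩, ⟨11, 1, 121, 143, 143⟩]),
      (29, [⟨24, 1, 0, 24, 120⟩, ⟨29, 1, 24, 140, 140⟩])]),
  ((216, 53), [
      (2, [⟨16, 19, 0, 16, 3456⟩, ⟨128, 127, 16, 144, 27248⟩, ⟨64, 63, 144, 208, 13552⟩,
        ⟨8, 7, 208, 216, 1512⟩]),
      (3, [⟨9, 5, 0, 27, 972⟩, ⟨81, 40, 27, 189, 8613⟩, ⟨27, 13, 189, 216, 2808⟩])]),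
  ((288, 53), [
      (3, [⟨9, 5, 0, 18, 1296⟩, ⟨243, 121, 18, 261, 34740⟩, ⟨27, 13, 261, 288, 3744⟩]),
      (19, [⟨19, 1, 0, 285, 285⟩])]),
  ((4320, 55), [
      (2, [⟨16, 17, 0, 32, 69104⟩, ⟨4096, 4095, 32, 4128, 17682400⟩,
        ⟨128, 127, 4128, 4256, 548576⟩, ⟨64, 63, 4256, 4320, 272160⟩]),
      (7, [⟨2401, 400, 1, 2402, 1724318⟩, ⟨343, 57, 2402, 4117, 245988⟩,
        ⟨49, 8, 4117, 4313, 34553⟩])]),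
  ((216, 59), [
      (2, [⟨20, 23, 0, 20, 4340⟩, ⟨128, 127, 24, 152, 27368⟩, ⟨64, 63, 152, 216, 13608⟩]),
      (5, [⟨25, 7, 1, 26, 1332⟩, ⟨125, 31, 26, 151, 6556⟩, ⟨25, 6, 151, 201, 1281⟩,
        ⟨5, 1, 201, 216, 216⟩]),
      (13, [⟨169, 14, 3, 172, 2915⟩])]),
  ((216, 63), [
      (3, [⟨27, 14, 0, 54, 2916⟩, ⟨81, 40, 54, 216, 8640⟩]),
      (29, [⟨29, 1, 0, 203, 203⟩])]),
  ((288, 63), [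
      (2, [⟨256, 255, 32, 288, 73440⟩]),
      (7, [⟨3, 1, 0, 9, 144⟩, ⟨5, 1, 9, 14, 234⟩, ⟨49, 8, 14, 259, 2268⟩,
        ⟨7, 1, 259, 287, 287⟩]),
      (11, [⟨121, 12, 0, 242, 3388⟩, ⟨11, 1, 242, 286, 286⟩]),
      (31, [⟨31, 1, 0, 279, 279⟩])]),
  ((432, 63), [
      (3, [⟨5, 3, 0, 10, 1080⟩, ⟨17, 9, 10, 27, 3660⟩, ⟨243, 121, 27, 270, 52110⟩,
        ⟨81, 40, 270, 432, 17280⟩]),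
      (11, [⟨11, 2, 1, 12, 475⟩, ⟨121, 12, 12, 375, 5105⟩, ⟨11, 1, 375, 430, 430⟩]),
      (13, [⟨169, 14, 2, 340, 5943⟩, ⟨13, 1, 340, 431, 431⟩])]),
  ((672, 63), [
      (5, [⟨625, 156, 11, 636, 104216⟩]),
      (11, [⟨11, 2, 0, 11, 737⟩, ⟨121, 12, 11, 616, 7997⟩, ⟨11, 1, 616, 671, 671⟩]),
      (37, [⟨37, 1, 0, 666, 666⟩])]),
  ((180, 71), [
      (3, [⟨9, 7, 0, 9, 819⟩, ⟨81, 40, 9, 171, 7164⟩, ⟨9, 4, 171, 180, 720⟩]),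
      (5, [⟨125, 31, 5, 130, 5530⟩, ⟨25, 6, 130, 180, 1080⟩])]),
  ((192, 71), [
      (3, [⟨3, 2, 0, 3, 291⟩, ⟨9, 5, 3, 30, 870⟩, ⟨81, 40, 30, 192, 7680⟩]),
      (19, [⟨19, 1, 0, 190, 190⟩]),
      (23, [⟨23, 1, 0, 184, 184⟩])]),
  ((216, 71), [
      (3, [⟨27, 14, 0, 54, 2916⟩, ⟨81, 40, 54, 216, 8640⟩]),
      (29, [⟨29, 1, 0, 203, 203⟩])]),
  ((216, 79), [
      (3, [⟨27, 14, 0, 54, 2916⟩, ⟨81, 40, 54, 216, 8640⟩]),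
      (29, [⟨29, 1, 6, 209, 209⟩])]),
  ((576, 79), [
      (3, [⟨243, 121, 9, 495, 69615⟩, ⟨81, 40, 495, 576, 23040⟩]),
      (23, [⟨529, 24, 0, 529, 13754⟩, ⟨23, 1, 529, 575, 575⟩])]),
  ((144, 80), [
      (11, [⟨121, 12, 0, 121, 1694⟩, ⟨11, 1, 121, 143, 143⟩]),
      (13, [⟨65, 6, 0, 65, 780⟩, ⟨13, 1, 65, 143, 143⟩])]),
  ((192, 80), [
      (13, [⟨169, 14, 0, 169, 2535⟩]),
      (41, [⟨27, 1, 0, 27, 135⟩, ⟨41, 1, 27, 191, 191⟩])]),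
  ((216, 80), [
      (3, [⟨27, 14, 0, 54, 2916⟩, ⟨81, 40, 54, 216, 8640⟩]),
      (29, [⟨29, 1, 7, 210, 210⟩])]),
  ((320, 80), [
      (29, [⟨29, 1, 0, 319, 319⟩]),
      (31, [⟨31, 1, 0, 310, 310⟩])]),
  ((432, 80), [
      (3, [⟨9, 5, 0, 27, 1944⟩, ⟨243, 121, 27, 270, 52110⟩, ⟨81, 40, 270, 432, 17280⟩]),
      (19, [⟨361, 20, 0, 361, 8303⟩]),
      (29, [⟨20, 1, 0, 20, 300⟩, ⟨29, 1, 20, 426, 426⟩])]),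
  ((576, 80), [
      (3, [⟨243, 121, 9, 495, 69615⟩, ⟨81, 40, 495, 576, 23040⟩]),
      (23, [⟨529, 24, 0, 529, 13754⟩, ⟨23, 1, 529, 575, 575⟩])]),
  ((720, 80), [
      (2, [⟨512, 511, 80, 592, 367536⟩]),
      (3, [⟨36, 19, 0, 72, 12960⟩, ⟨243, 121, 72, 558, 86958⟩, ⟨81, 40, 558, 720, 28800⟩]),
      (7, [⟨343, 57, 17, 703, 40757⟩])]),
  ((4320, 80), [
      (2, [⟨64, 65, 0, 64, 276352⟩, ⟨4096, 4095, 64, 4160, 17682368⟩,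
        ⟨128, 127, 4160, 4288, 548544⟩, ⟨32, 31, 4288, 4320, 133920⟩]),
      (7, [⟨2401, 400, 0, 2401, 1723918⟩, ⟨343, 57, 2401, 4116, 245931⟩,
        ⟨49, 8, 4116, 4312, 34545⟩])])]

set_option maxHeartbeats 4000000 in
lemma checkIrreducible_certificates :
    certificates.all fun t ↦ checkIrreducible t.1.1 t.1.2 t.2 := by
  decide +kernel

end G1

theorem g1_irreducible_T_pairs (n s : ℕ)
    (h : (n, s) ∈ ({(272,17), (144,21), (144,23), (144,25), (144,26), (312,26), (600,26),
      (216,29), (216,31), (720,31), (240,35), (1440,35), (288,40), (288,41), (216,42),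
      (216,44), (216,47), (288,47), (288,48), (216,49), (144,51), (288,51), (144,53),
      (216,53), (288,53), (4320,55), (216,59), (216,63), (288,63), (432,63), (672,63),
      (180,71), (192,71), (216,71), (216,79), (576,79), (144,80), (192,80), (216,80),
      (320,80), (432,80), (576,80), (720,80), (4320,80)} : Set (ℕ × ℕ))) :
    Irreducible (g1 n s) := by
  have hmem : (n, s) ∈ G1.certificates.map Prod.fst := by
    simpa [G1.certificates] using h
  obtain ⟨⟨_, cs⟩, ht, rfl⟩ := List.mem_map.1 hmem
  exact G1.irreducible_of_check cs (List.all_eq_true.1 G1.checkIrreducible_certificates _ ht)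
end
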